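/- arXiv:1605.04297 — 2 statements merged into one kernel-verified Lean document; each statement's English description precedes it below -/
import Mathlib

section
/- The only growth rates of monotone griddable permutation classes less than 1+φ are 0, 1, and 2: if a permutation class C is 𝒢-griddable for 𝒢 = Av(21) ∪ Av(12) (the class of monotone permutations) and ugr(C) < (3+√5)/2, then the growth rate gr(C) exists and gr(C) ∈ {0, 1, 2}. -/
open Filter

/-- A permutation of some finite length `n`. -/
abbrev Permu : Type := Σ n : ℕ, Equiv.Perm (Fin n)

/-- `PLe σ π` : the permutation `σ` is contained in `π` as a pattern. -/
def PLe (σ π : Permu) : Prop :=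
  ∃ f : Fin σ.1 → Fin π.1, StrictMono f ∧
    ∀ i j : Fin σ.1, σ.2 i < σ.2 j ↔ π.2 (f i) < π.2 (f j)

/-- A permutation class: a set of permutations closed downward under containment. -/
def IsPermClass (C : Set Permu) : Prop :=
  ∀ σ π : Permu, PLe σ π → π ∈ C → σ ∈ C

/-- The number of permutations of length `n` in `C`. -/
noncomputable def pcount (C : Set Permu) (n : ℕ) : ℕ :=
  Set.ncard {π ∈ C | π.1 = n}

/-- The upper growth rate of a class, as an extended real. -/
noncomputable def ugr (C : Set Permu) : EReal :=
  limsup (fun n : ℕ => (((pcount C n : ℝ) ^ ((n : ℝ)⁻¹) : ℝ) : EReal)) atTop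

/-- The lower growth rate of a class, as an extended real. -/
noncomputable def lgr (C : Set Permu) : EReal :=
  liminf (fun n : ℕ => (((pcount C n : ℝ) ^ ((n : ℝ)⁻¹) : ℝ) : EReal)) atTop
/-- `IsPatternOf σ π S` : the entries of `π` at the set `S` of indices are order
isomorphic to `σ`. -/
def IsPatternOf (σ π : Permu) (S : Set (Fin π.1)) : Prop :=
  ∃ f : Fin σ.1 → Fin π.1, StrictMono f ∧ Set.range f = S ∧
    ∀ i j : Fin σ.1, σ.2 i < σ.2 j ↔ π.2 (f i) < π.2 (f j)

/-- `Griddable G C` : there is a bound `k` such that every member of `C` can be divided,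
by at most `k` column divisions and at most `k` row divisions (in 1-based coordinates,
running from `1` to `n+1`), into cells each of whose contents is order isomorphic to a
(possibly empty) member of `G`. -/
def Griddable (G : Set Permu) (C : Set Permu) : Prop :=
  ∃ k : ℕ, ∀ π ∈ C, ∃ t u : ℕ, t ≤ k ∧ u ≤ k ∧
    ∃ c : Fin (t + 1) → ℕ, ∃ r : Fin (u + 1) → ℕ,
      Monotone c ∧ Monotone r ∧
      c 0 = 1 ∧ c (Fin.last t) = π.1 + 1 ∧
      r 0 = 1 ∧ r (Fin.last u) = π.1 + 1 ∧
      ∀ (i : Fin t) (j : Fin u),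
        ∃ σ : Permu, (σ ∈ G ∨ σ.1 = 0) ∧
          IsPatternOf σ π
            {x : Fin π.1 |
              c i.castSucc ≤ (x : ℕ) + 1 ∧ (x : ℕ) + 1 < c i.succ ∧
              r j.castSucc ≤ (π.2 x : ℕ) + 1 ∧ (π.2 x : ℕ) + 1 < r j.succ}
/-- The class of monotone permutations, `Av(21) ∪ Av(12)`. -/
def MonotoneClass : Set Permu := {π | StrictMono ⇑π.2 ∨ StrictAnti ⇑π.2}

namespace MG

open Classical in
/-- monotone functions -/
noncomputable def monF (n k : ℕ) : Finset (Fin n → Fin k) :=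
  Finset.univ.filter (fun f => Monotone f)

lemma card_monF (n k : ℕ) : (monF n k).card ≤ (n + 1) ^ k := by
  classical
  let F : (Fin n → Fin k) → (Fin k → Fin (n + 1)) := fun f i =>
    ⟨(Finset.univ.filter (fun x => f x ≤ i)).card, by
      have := Finset.card_le_univ (Finset.univ.filter (fun x => f x ≤ i))
      simp only [Fintype.card_fin] at this
      omega⟩
  have key : ∀ f ∈ monF n k, ∀ g ∈ monF n k, F f = F g → ∀ x, f x ≤ g x := by
    intro f hf g hg h x
    by_contra hlt
    push Not at hlt
    simp only [monF, Finset.mem_filter, Finset.mem_univ, true_and] at hf hg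
    have h1 := congrFun h (g x)
    simp only [F, Fin.mk.injEq] at h1
    have : (Finset.univ.filter (fun y => f y ≤ g x)) ⊂ (Finset.univ.filter (fun y => g y ≤ g x)) := by
      rw [Finset.ssubset_iff_of_subset]
      · exact ⟨x, by simp, by simpa using hlt⟩
      · intro y hy
        simp only [Finset.mem_filter, Finset.mem_univ, true_and] at hy ⊢
        apply hg
        by_contra hxy
        push Not at hxy
        have := hf hxy.le
        exact absurd (lt_of_lt_of_le hlt this) (not_lt.mpr hy)
    have := Finset.card_lt_card this
    omega
  have : (monF n k).card ≤ (Finset.univ : Finset (Fin k → Fin (n + 1))).card := by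
    apply Finset.card_le_card_of_injOn F (by intro x _; simp)
    intro f hf g hg h
    funext x
    exact le_antisymm (key f hf g hg h x) (key g hg f hf h.symm x)
  simpa using this

/-- word without factor `20`. -/
def NoCA {m : ℕ} (w : Fin m → Fin 3) : Prop :=
  ∀ (i : ℕ) (h : i + 1 < m), ¬ (w ⟨i, by omega⟩ = 2 ∧ w ⟨i + 1, h⟩ = 0)

lemma exists_b {m : ℕ} (w : Fin m → Fin 3) (hw : NoCA w) (x : ℕ) :
    ∀ (y : ℕ) (hy : y < m) (hxy : x < y), w ⟨x, by omega⟩ = 2 → w ⟨y, hy⟩ = 0 →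
      ∃ (z : ℕ) (hz : z < y), x < z ∧ w ⟨z, by omega⟩ = 1 := by
  intro y
  induction y with
  | zero => intro _ h; omega
  | succ y ih =>
    intro hy hxy hx h0
    rcases Nat.lt_or_ge x y with hlt | hge
    · have h3 : w ⟨y, by omega⟩ = 0 ∨ w ⟨y, by omega⟩ = 1 ∨ w ⟨y, by omega⟩ = 2 := by
        generalize w ⟨y, by omega⟩ = t
        fin_cases t <;> simp
      rcases h3 with h3 | h3 | h3
      · obtain ⟨z, hz, h4, h5⟩ := ih (by omega) hlt hx h3
        exact ⟨z, by omega, h4, h5⟩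
      · exact ⟨y, by omega, hlt, h3⟩
      · exact absurd ⟨h3, h0⟩ (hw y hy)
    · have : x = y := by omega
      subst this
      exact absurd ⟨hx, h0⟩ (hw x hy)

lemma perm_eq_one {m : ℕ} (Φ : Equiv.Perm (Fin m))
    (h : ∀ (i : ℕ) (h : i + 1 < m), Φ ⟨i, by omega⟩ < Φ ⟨i + 1, h⟩) (i : Fin m) : Φ i = i := by
  have hs : StrictMono Φ := by
    cases m with
    | zero => intro a; exact a.elim0
    | succ m =>
      rw [Fin.strictMono_iff_lt_succ]
      intro i
      exact h i.1 (by omega)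
  have h1 := hs.le_apply (x := i)
  have h2 : StrictMono Φ.symm := by
    intro a b hab
    by_contra hc
    push Not at hc
    have := hs.monotone hc
    simp at this
    exact absurd hab (not_lt.mpr this)
  have h3 := hs.monotone (h2.le_apply (x := i))
  simp at h3
  exact le_antisymm h3 h1

lemma word_unique {m : ℕ} (w w' : Fin m → Fin 3) (hw : NoCA w) (hw' : NoCA w')
    (Φ : Equiv.Perm (Fin m)) (hΦ : ∀ i, w' (Φ i) = w i)
    (hab : ∀ i j, w i ≠ 2 → w j ≠ 2 → i < j → Φ i < Φ j)
    (hbc : ∀ i j, w i ≠ 0 → w j ≠ 0 → i < j → Φ i < Φ j) : w = w' := by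
  have key : ∀ (i : ℕ) (h : i + 1 < m), Φ ⟨i, by omega⟩ < Φ ⟨i + 1, h⟩ := by
    intro i h
    have hlt : (⟨i, by omega⟩ : Fin m) < ⟨i + 1, h⟩ := by simp [Fin.lt_def]
    by_contra hc
    have hne : Φ ⟨i, by omega⟩ ≠ Φ ⟨i + 1, h⟩ := fun e => hlt.ne (Φ.injective e)
    have hc' : Φ ⟨i + 1, h⟩ < Φ ⟨i, by omega⟩ := lt_of_le_of_ne (not_lt.mp hc) hne.symm
    have h1 := fun u v => hab _ _ u v hlt
    have h2 := fun u v => hbc _ _ u v hlt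
    have hi : w ⟨i, by omega⟩ = 0 ∧ w ⟨i+1, h⟩ = 2 := by
      have h3 := hw i h
      generalize w ⟨i, by omega⟩ = s at *
      generalize w ⟨i+1, h⟩ = t at *
      by_cases hs0 : s = 0
      · by_cases ht : t = 2
        · exact ⟨hs0, ht⟩
        · exact absurd (h1 (by subst hs0; decide) ht) hc
      · by_cases ht : t = 0
        · by_cases hs2 : s = 2
          · exact absurd ⟨hs2, ht⟩ h3
          · exact absurd (h1 hs2 (by subst ht; decide)) hc
        · exact absurd (h2 hs0 ht) hc
    obtain ⟨z, hz, hxz, hb⟩ := exists_b w' hw' (Φ ⟨i+1, h⟩).1 (Φ ⟨i, by omega⟩).1 (Φ ⟨i, by omega⟩).2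
      hc' (by rw [← hi.2, ← hΦ]) (by rw [← hi.1, ← hΦ])
    have hzm : z < m := by have := (Φ ⟨i, by omega⟩).2; omega
    set l := Φ.symm ⟨z, hzm⟩ with hl
    have hl' : Φ l = ⟨z, hzm⟩ := by simp [hl]
    have hwl : w l = 1 := by rw [← hΦ, hl']; exact hb
    have g1 : (⟨i + 1, h⟩ : Fin m) < l := by
      by_contra hcc
      rcases (not_lt.mp hcc).lt_or_eq with h5 | h5
      · have := hbc _ _ (by rw [hwl]; decide) (by rw [hi.2]; decide) h5
        rw [hl', Fin.lt_def] at this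
        simp only at this
        omega
      · rw [h5, hi.2] at hwl; exact absurd hwl (by decide)
    have g2 : l < ⟨i, by omega⟩ := by
      by_contra hcc
      rcases (not_lt.mp hcc).lt_or_eq with h5 | h5
      · have := hab _ _ (by rw [hi.1]; decide) (by rw [hwl]; decide) h5
        rw [hl', Fin.lt_def] at this
        simp only at this
        omega
      · rw [← h5, hi.1] at hwl; exact absurd hwl (by decide)
    exact absurd (g1.trans g2) (by simp [Fin.lt_def])
  funext i
  rw [← hΦ, perm_eq_one Φ key]

/-- words avoiding `20`, and those not starting with `0`. -/
lemma words_count (m : ℕ) : ∃ W V : Finset (Fin m → Fin 3), V ⊆ W ∧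
    (∀ w ∈ W, NoCA w) ∧ (∀ w ∈ V, ∀ h : 0 < m, w ⟨0, h⟩ ≠ 0) ∧
    ((3 + Real.sqrt 5) / 2) ^ m ≤ (W.card : ℝ) ∧
    ((Real.sqrt 5 - 1) / 2) * ((3 + Real.sqrt 5) / 2) ^ m ≤ (V.card : ℝ) := by
  have hs : Real.sqrt 5 * Real.sqrt 5 = 5 := Real.mul_self_sqrt (by norm_num)
  have hs0 : 0 ≤ Real.sqrt 5 := Real.sqrt_nonneg 5
  induction m with
  | zero =>
    refine ⟨Finset.univ, Finset.univ, le_refl _, ?_, ?_, by simp, ?_⟩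
    · intro w _ i h; omega
    · intro w _ h; omega
    · simp; nlinarith
  | succ m ih =>
    classical
    obtain ⟨W, V, hVW, hW, hV, cW, cV⟩ := ih
    have inj : ∀ x : Fin 3, Function.Injective (fun w : Fin m → Fin 3 => (Fin.cons x w : Fin (m+1) → Fin 3)) := by
      intro x a b h
      exact (Fin.cons_right_injective (α := fun _ => Fin 3) x) h
    let I : Fin 3 → Finset (Fin m → Fin 3) → Finset (Fin (m+1) → Fin 3) := fun x S =>
      S.map ⟨_, inj x⟩
    have hd : ∀ x y S T, x ≠ y → Disjoint (I x S) (I y T) := by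
      intro x y S T hxy
      rw [Finset.disjoint_left]
      intro w h1 h2
      simp only [I, Finset.mem_map, Function.Embedding.coeFn_mk] at h1 h2
      obtain ⟨a, _, ha⟩ := h1
      obtain ⟨b, _, hb⟩ := h2
      apply hxy
      have := congrFun (ha.trans hb.symm) 0
      simpa using this
    have hI : ∀ x S, (I x S).card = S.card := by intro x S; simp [I]
    have noca : ∀ (x : Fin 3) (w : Fin m → Fin 3), NoCA w → (x ≠ 2 ∨ ∀ h : 0 < m, w ⟨0, h⟩ ≠ 0) →
        NoCA (Fin.cons x w : Fin (m+1) → Fin 3) := by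
      intro x w hw hx i h
      cases i with
      | zero =>
        rintro ⟨h1, h2⟩
        have h1' : x = 2 := h1
        have h2' : w ⟨0, by omega⟩ = 0 := h2
        rcases hx with hx | hx
        · exact hx h1'
        · exact hx _ h2'
      | succ i => exact hw i (by omega)
    refine ⟨I 0 W ∪ (I 1 W ∪ I 2 V), I 1 W ∪ I 2 V, Finset.subset_union_right, ?_, ?_, ?_, ?_⟩
    · intro w hw
      simp only [I, Finset.mem_union, Finset.mem_map, Function.Embedding.coeFn_mk] at hw
      rcases hw with ⟨v, hv, rfl⟩ | ⟨v, hv, rfl⟩ | ⟨v, hv, rfl⟩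
      · exact noca _ _ (hW v hv) (Or.inl (by decide))
      · exact noca _ _ (hW v hv) (Or.inl (by decide))
      · exact noca _ _ (hW v (hVW hv)) (Or.inr (hV v hv))
    · intro w hw _
      simp only [I, Finset.mem_union, Finset.mem_map, Function.Embedding.coeFn_mk] at hw
      rcases hw with ⟨v, hv, rfl⟩ | ⟨v, hv, rfl⟩
      · change (1 : Fin 3) ≠ 0; decide
      · change (2 : Fin 3) ≠ 0; decide
    · rw [Finset.card_union_of_disjoint, Finset.card_union_of_disjoint (hd _ _ _ _ (by decide)), hI, hI, hI]
      · push_cast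
        rw [pow_succ]
        nlinarith
      · rw [Finset.disjoint_union_right]
        exact ⟨hd _ _ _ _ (by decide), hd _ _ _ _ (by decide)⟩
    · rw [Finset.card_union_of_disjoint (hd _ _ _ _ (by decide)), hI, hI]
      push_cast
      rw [pow_succ]
      have : (Real.sqrt 5 - 1) / 2 * (((3 + Real.sqrt 5) / 2) ^ m * ((3 + Real.sqrt 5) / 2))
        = ((1 + Real.sqrt 5)/2) * ((3 + Real.sqrt 5) / 2) ^ m := by
          generalize ((3 + Real.sqrt 5) / 2) ^ m = t
          linear_combination (t/4) * hs
      rw [this]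
      nlinarith

lemma words2_count (m : ℕ) : ∃ W : Finset (Fin m → Fin 3),
    (∀ w ∈ W, ∀ i, w i ≠ 2) ∧ (2 : ℝ) ^ m ≤ (W.card : ℝ) := by
  classical
  let e : (Fin m → Fin 2) → (Fin m → Fin 3) := fun w i => (w i).castSucc
  have he : Function.Injective e := by
    intro a b h
    funext i
    have := congrFun h i
    simpa [e] using this
  refine ⟨Finset.univ.map ⟨e, he⟩, ?_, ?_⟩
  · intro w hw i
    simp only [Finset.mem_map, Finset.mem_univ, true_and, Function.Embedding.coeFn_mk] at hw
    obtain ⟨v, rfl⟩ := hw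
    simp only [e]
    generalize v i = t
    revert t
    decide
  · simp

/-- gridding data -/
structure GR (k n : ℕ) (π : Equiv.Perm (Fin n)) (α β : Fin n → Fin k) : Prop where
  ma : Monotone α
  mb : Monotone β
  mono : ∀ i j,
    (∀ p q, α p = i → α q = i → β (π p) = j → β (π q) = j → p < q → π p < π q) ∨
    (∀ p q, α p = i → α q = i → β (π p) = j → β (π q) = j → p < q → π q < π p)

open Classical in
/-- members of length n -/
noncomputable def mem (C : Set Permu) (n : ℕ) : Finset (Equiv.Perm (Fin n)) :=
  Finset.univ.filter (fun σ => (⟨n, σ⟩ : Permu) ∈ C)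

lemma pcount_eq (C : Set Permu) (n : ℕ) : pcount C n = (mem C n).card := by
  classical
  unfold pcount
  rw [← Set.ncard_coe_finset]
  have : {π ∈ C | π.1 = n} = (fun σ : Equiv.Perm (Fin n) => (⟨n, σ⟩ : Permu)) '' (mem C n : Set _) := by
    ext ⟨m, σ⟩
    simp only [mem, Set.mem_ofPred_eq, Finset.coe_filter, Finset.mem_univ, true_and, Set.mem_image]
    constructor
    · rintro ⟨h1, rfl⟩
      exact ⟨σ, h1, rfl⟩
    · rintro ⟨τ, h1, h2⟩
      cases h2
      exact ⟨h1, rfl⟩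
  rw [this, Set.ncard_image_of_injective]
  intro a b h
  simpa using h

/-- The sorted enumeration of an injective family of points together with the pattern. -/
lemma pattern_exists {m n : ℕ} (π : Equiv.Perm (Fin n)) (P : Fin m → Fin n)
    (hP : Function.Injective P) :
    ∃ (e σ : Equiv.Perm (Fin m)) (f : Fin m → Fin n), StrictMono f ∧ (∀ i, P i = f (e i)) ∧
      (∀ i j, σ i < σ j ↔ π (f i) < π (f j)) ∧ StrictMono (fun i => π (f (σ.symm i))) := by
  let s := Tuple.sort P
  have hf : StrictMono (P ∘ s) :=
    (Tuple.monotone_sort P).strictMono_of_injective (hP.comp s.injective)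
  let u := Tuple.sort (fun i => π ((P ∘ s) i))
  have hu : StrictMono ((fun i => π ((P ∘ s) i)) ∘ u) :=
    (Tuple.monotone_sort (fun i => π ((P ∘ s) i))).strictMono_of_injective
      ((π.injective.comp hf.injective).comp u.injective)
  refine ⟨s.symm, u.symm, P ∘ s, hf, by simp, ?_, by exact hu⟩
  intro i j
  rw [← hu.lt_iff_lt]
  simp

/-- coordinates -/
def Yc {n : ℕ} (π : Equiv.Perm (Fin n)) (inc d : Bool) (p : Fin n) : ℤ :=
  if d then (if inc then ((p : ℕ) : ℤ) else -((p : ℕ) : ℤ)) else ((π p : ℕ) : ℤ)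

lemma Yc_iso {n : ℕ} (π : Equiv.Perm (Fin n)) (inc d : Bool) (p q p' q' : Fin n)
    (h1 : p < q ↔ p' < q') (h1' : q < p ↔ q' < p') (h2 : π p < π q ↔ π p' < π q') :
    Yc π inc d p < Yc π inc d q ↔ Yc π inc d p' < Yc π inc d q' := by
  rw [Fin.lt_def, Fin.lt_def] at *
  cases d <;> cases inc <;> simp [Yc] <;> assumption

lemma lower_bound (C : Set Permu) (hC : IsPermClass C) {n k m : ℕ} (π : Equiv.Perm (Fin n))
    (hπ : (⟨n, π⟩ : Permu) ∈ C) (α β : Fin n → Fin k) (hG : GR k n π α β)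
    (P : Fin m → Fin 3 → Fin n) (cl : Fin 3 → Fin k × Fin k)
    (hcl : ∀ i x, (α (P i x), β (π (P i x))) = cl x)
    (inc d d' : Bool)
    (hab : ∀ i j x y, i < j → x ≠ 2 → y ≠ 2 → Yc π inc d (P i x) < Yc π inc d (P j y))
    (hbc : ∀ i j x y, i < j → x ≠ 0 → y ≠ 0 → Yc π inc d' (P i x) < Yc π inc d' (P j y))
    (W : Finset (Fin m → Fin 3)) (hW : ∀ w ∈ W, NoCA w)
    (hd : ∀ w ∈ W, ∀ w' ∈ W, ∀ i j, cl (w i) = cl (w' j) → w i = w' j) :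
    W.card ≤ pcount C m * (m + 1) ^ (2 * k) := by
  classical
  have hinj : ∀ w ∈ W, Function.Injective (fun i => P i (w i)) := by
    intro w hw
    have : ∀ i j, i < j → P i (w i) ≠ P j (w j) := by
      intro i j hij he
      have he' := hd w hw w hw i j (by rw [← hcl i, ← hcl j, he])
      by_cases h2 : w i = 2
      · have := hbc i j (w i) (w j) hij (by rw [h2]; decide) (by rw [← he', h2]; decide)
        rw [he] at this
        exact lt_irrefl _ this
      · have := hab i j (w i) (w j) hij h2 (by rw [← he']; exact h2)
        rw [he] at this
        exact lt_irrefl _ this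
    intro i j h
    rcases lt_trichotomy i j with h1 | h1 | h1
    · exact absurd h (this i j h1)
    · exact h1
    · exact absurd h.symm (this j i h1)
  have hex : ∀ w : Fin m → Fin 3, ∃ (e σ : Equiv.Perm (Fin m)) (f : Fin m → Fin n), w ∈ W →
      (StrictMono f ∧ (∀ i, P i (w i) = f (e i)) ∧
      (∀ i j, σ i < σ j ↔ π (f i) < π (f j)) ∧ StrictMono (fun i => π (f (σ.symm i)))) := by
    intro w
    by_cases hw : w ∈ W
    · obtain ⟨e, σ, f, h⟩ := pattern_exists π _ (hinj w hw)
      exact ⟨e, σ, f, fun _ => h⟩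
    · cases m with
      | zero => exact ⟨1, 1, fun i => i.elim0, fun h => absurd h hw⟩
      | succ m => exact ⟨1, 1, fun i => P i 0, fun h => absurd h hw⟩
  choose e σ f hef using hex
  let D : (Fin m → Fin 3) → Equiv.Perm (Fin m) × (Fin m → Fin k) × (Fin m → Fin k) :=
    fun w => (σ w, fun i => α (f w i), fun i => β (π (f w ((σ w).symm i))))
  have hmaps : ∀ w ∈ W, D w ∈ mem C m ×ˢ (monF m k ×ˢ monF m k) := by
    intro w hw
    obtain ⟨h1, h2, h3, h4⟩ := hef w hw
    simp only [D, Finset.mem_product, mem, monF, Finset.mem_filter, Finset.mem_univ, true_and]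
    refine ⟨hC _ _ ⟨f w, h1, h3⟩ hπ, hG.ma.comp h1.monotone, hG.mb.comp h4.monotone⟩
  have hDinj : Set.InjOn D W := by
    intro w hw w' hw' hD
    obtain ⟨h1, h2, h3, h4⟩ := hef w hw
    obtain ⟨h1', h2', h3', h4'⟩ := hef w' hw'
    simp only [D, Prod.mk.injEq] at hD
    obtain ⟨D1, D2, D3⟩ := hD
    let Φ : Equiv.Perm (Fin m) := (e w).trans (e w').symm
    have hP' : ∀ i, P (Φ i) (w' (Φ i)) = f w' (e w i) := by
      intro i; rw [h2']; simp [Φ]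
    have hcell : ∀ i, w' (Φ i) = w i := by
      intro i
      apply hd w' hw' w hw
      rw [← hcl (Φ i), ← hcl i, hP', h2]
      have a1 := congrFun D2 (e w i)
      have a2 := congrFun D3 (σ w (e w i))
      rw [← D1] at a2
      simp only [Equiv.symm_apply_apply] at a1 a2
      rw [a1, a2]
    have pos : ∀ i j, P i (w i) < P j (w j) ↔ P (Φ i) (w' (Φ i)) < P (Φ j) (w' (Φ j)) := by
      intro i j
      rw [hP', hP', h2, h2, h1.lt_iff_lt, h1'.lt_iff_lt]
    have val : ∀ i j, π (P i (w i)) < π (P j (w j)) ↔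
        π (P (Φ i) (w' (Φ i))) < π (P (Φ j) (w' (Φ j))) := by
      intro i j
      rw [hP', hP', h2, h2, ← h3, ← h3', D1]
    have ord : ∀ b i j, Yc π inc b (P i (w i)) < Yc π inc b (P j (w j)) ↔
        Yc π inc b (P (Φ i) (w' (Φ i))) < Yc π inc b (P (Φ j) (w' (Φ j))) := by
      intro b i j
      exact Yc_iso π inc b _ _ _ _ (pos i j) (pos j i) (val i j)
    apply word_unique w w' (hW w hw) (hW w' hw') Φ hcell
    · intro i j hi hj hij
      by_contra hc
      have hne : Φ j ≠ Φ i := fun h => hij.ne' (Φ.injective h)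
      have h5 := lt_of_le_of_ne (not_lt.mp hc) hne
      have h6 := (ord d i j).mp (hab i j _ _ hij hi hj)
      have h7 := hab (Φ j) (Φ i) (w' (Φ j)) (w' (Φ i)) h5 (by rwa [hcell]) (by rwa [hcell])
      exact lt_asymm h6 h7
    · intro i j hi hj hij
      by_contra hc
      have hne : Φ j ≠ Φ i := fun h => hij.ne' (Φ.injective h)
      have h5 := lt_of_le_of_ne (not_lt.mp hc) hne
      have h6 := (ord d' i j).mp (hbc i j _ _ hij hi hj)
      have h7 := hbc (Φ j) (Φ i) (w' (Φ j)) (w' (Φ i)) h5 (by rwa [hcell]) (by rwa [hcell])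
      exact lt_asymm h6 h7
  have := Finset.card_le_card_of_injOn D hmaps hDinj
  rw [Finset.card_product, Finset.card_product, ← pcount_eq] at this
  calc W.card ≤ _ := this
    _ ≤ pcount C m * ((m+1)^k * (m+1)^k) := by
      gcongr <;> exact card_monF m k
    _ = _ := by rw [← pow_add, two_mul]

lemma det {n : ℕ} {κ : Type*} (π π' : Equiv.Perm (Fin n)) (a b : Fin n → κ)
    (h : ∀ p, b (π p) = a p) (h' : ∀ p, b (π' p) = a p) (M : κ → Bool)
    (hm : ∀ p q, a p = a q → p < q → if M (a p) then π p < π q else π q < π p)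
    (hm' : ∀ p q, a p = a q → p < q → if M (a p) then π' p < π' q else π' q < π' p) : π = π' := by
  classical
  -- Number of points in the cell that lie below a given value
  have key : ∀ (τ : Equiv.Perm (Fin n)), (∀ p, b (τ p) = a p) →
      (∀ p q, a p = a q → p < q → if M (a p) then τ p < τ q else τ q < τ p) → ∀ p,
      (Finset.univ.filter (fun v => b v = a p ∧ v < τ p)).card =
      (Finset.univ.filter (fun q => a q = a p ∧ if M (a p) then q < p else p < q)).card := by
    intro τ hτ hmτ p
    symm
    apply Finset.card_bij (fun q _ => τ q)
    · intro q hq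
      simp only [Finset.mem_filter, Finset.mem_univ, true_and] at hq ⊢
      refine ⟨by rw [hτ, hq.1], ?_⟩
      have h2 := hq.2
      split_ifs at h2 with hM
      · have := hmτ q p hq.1 h2
        rwa [hq.1, if_pos hM] at this
      · have := hmτ p q hq.1.symm h2
        rwa [if_neg hM] at this
    · intro x _ y _ hxy; exact τ.injective hxy
    · intro v hv
      simp only [Finset.mem_filter, Finset.mem_univ, true_and] at hv
      refine ⟨τ.symm v, ?_, by simp⟩
      simp only [Finset.mem_filter, Finset.mem_univ, true_and]
      have hav : a (τ.symm v) = a p := by rw [← hτ, ← hv.1]; simp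
      refine ⟨hav, ?_⟩
      have hne : τ.symm v ≠ p := by
        intro e; rw [← e] at hv; simp at hv
      split_ifs with hM
      · by_contra hc
        have h3 := lt_of_le_of_ne (not_lt.mp hc) hne.symm
        have := hmτ _ _ hav.symm h3
        rw [if_pos hM] at this
        simp only [Equiv.apply_symm_apply] at this
        exact lt_asymm this hv.2
      · by_contra hc
        have h3 := lt_of_le_of_ne (not_lt.mp hc) hne
        have := hmτ _ _ hav h3
        rw [hav, if_neg hM] at this
        simp only [Equiv.apply_symm_apply] at this
        exact lt_asymm this hv.2
  have mon : ∀ (c : κ) (x y : Fin n), b x = c → x < y →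
      (Finset.univ.filter (fun v => b v = c ∧ v < x)).card <
      (Finset.univ.filter (fun v => b v = c ∧ v < y)).card := by
    intro c x y hx hxy
    apply Finset.card_lt_card
    rw [Finset.ssubset_iff_of_subset]
    · exact ⟨x, by simp [hx, hxy], by simp⟩
    · intro v hv
      simp only [Finset.mem_filter, Finset.mem_univ, true_and] at hv ⊢
      exact ⟨hv.1, hv.2.trans hxy⟩
  ext1 p
  have e1 := key π h hm p
  have e2 := key π' h' hm' p
  rcases lt_trichotomy (π p) (π' p) with h1 | h1 | h1
  · have := mon (a p) _ _ (h p) h1; omega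
  · exact h1
  · have := mon (a p) _ _ (h' p) h1; omega

/-- Refined data. -/
structure RF (k K n q : ℕ) (π : Equiv.Perm (Fin n)) (α β : Fin n → Fin k) (α' β' : Fin n → Fin K) :
    Prop where
  gr : GR k n π α β
  ma : Monotone α'
  mb : Monotone β'
  ra : ∀ x y, α' x = α' y → α x = α y
  rb : ∀ x y, β' x = β' y → β x = β y
  c3 : ∀ x y z, α' x = α' y → α' x = α' z → β (π x) ≠ β (π y) → β (π x) ≠ β (π z) →
    β (π y) = β (π z)
  r3 : ∀ x y z, β' (π x) = β' (π y) → β' (π x) = β' (π z) → α x ≠ α y → α x ≠ α z → α y = α z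
  hq : ∀ PC PR : Finset (Fin n),
    (∀ p ∈ PC, ∃ x y, α' x = α' p ∧ α' y = α' p ∧ β (π x) ≠ β (π y)) →
    (∀ v ∈ PR, ∃ x y, β' (π x) = β' v ∧ β' (π y) = β' v ∧ α x ≠ α y) →
    PC.card + PR.card ≤ q

/-- encoding data type -/
abbrev DT (k K n : ℕ) : Type :=
  ((Fin n → Fin k) × (Fin n → Fin k) × (Fin n → Fin K) × (Fin n → Fin K)) ×
    (Fin k × Fin k → Bool) × (Fin K → Fin k → Bool) × (Fin K → Fin k → Bool)

lemma upper_bound (C : Set Permu) (n k K q : ℕ)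
    (H : ∀ π ∈ mem C n, ∃ α β α' β', RF k K n q π α β α' β') :
    pcount C n ≤ 2 ^ q * ((n + 1) ^ (2 * k + 2 * K) * 2 ^ (k * k + 2 * (K * k))) := by
  classical
  rw [pcount_eq]
  -- the code `D` is valid for `π`
  let Val : Equiv.Perm (Fin n) → DT k K n → Prop := fun π D =>
    RF k K n q π D.1.1 D.1.2.1 D.1.2.2.1 D.1.2.2.2 ∧
    (∀ p r, D.1.1 p = D.1.1 r → D.1.2.1 (π p) = D.1.2.1 (π r) → p < r →
      if D.2.1 (D.1.1 p, D.1.2.1 (π p)) then π p < π r else π r < π p) ∧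
    (∀ i j, D.2.2.1 i j = true ↔ ∃ x, D.1.2.2.1 x = i ∧ D.1.2.1 (π x) = j) ∧
    (∀ i j, D.2.2.2 i j = true ↔ ∃ x, D.1.2.2.2 (π x) = i ∧ D.1.1 x = j)
  have hval : ∀ π : Equiv.Perm (Fin n), π ∈ mem C n → ∃ D, Val π D := by
    intro π hπ
    obtain ⟨α, β, α', β', hR⟩ := H π hπ
    have hM : ∀ c : Fin k × Fin k, ∃ s : Bool,
      ∀ p r, α p = c.1 → α r = c.1 → β (π p) = c.2 → β (π r) = c.2 → p < r →
        if s then π p < π r else π r < π p := by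
      intro c
      rcases hR.gr.mono c.1 c.2 with h | h
      · exact ⟨true, by simpa using h⟩
      · exact ⟨false, by simpa using h⟩
    choose M hM using hM
    refine ⟨((α, β, α', β'), M, fun i j => decide (∃ x, α' x = i ∧ β (π x) = j),
      fun i j => decide (∃ x, β' (π x) = i ∧ α x = j)), hR, ?_, by simp, by simp⟩
    intro p r h1 h2 h3
    exact hM (α p, β (π p)) p r rfl h1.symm rfl h2.symm h3
  rcases (mem C n).eq_empty_or_nonempty with hemp | ⟨π₁, hπ₁⟩
  · simp [hemp]
  have : Nonempty (DT k K n) := ⟨(hval π₁ hπ₁).choose⟩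
  choose! D hD using hval
  have himg : ((mem C n).image D).card ≤ (n + 1) ^ (2 * k + 2 * K) * 2 ^ (k * k + 2 * (K * k)) := by
    have hsub : (mem C n).image D ⊆
        (monF n k ×ˢ monF n k ×ˢ monF n K ×ˢ monF n K) ×ˢ Finset.univ := by
      intro x hx
      rw [Finset.mem_image] at hx
      obtain ⟨π, hπ, rfl⟩ := hx
      have h1 := (hD π hπ).1
      simp only [Finset.mem_product, monF, Finset.mem_filter, Finset.mem_univ, true_and, and_true]
      exact ⟨h1.gr.ma, h1.gr.mb, h1.ma, h1.mb⟩
    refine (Finset.card_le_card hsub).trans ?_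
    rw [Finset.card_product, Finset.card_product, Finset.card_product, Finset.card_product]
    calc _ ≤ ((n+1)^k * ((n+1)^k * ((n+1)^K * (n+1)^K))) *
          (Finset.univ : Finset ((Fin k × Fin k → Bool) × (Fin K → Fin k → Bool) × (Fin K → Fin k → Bool))).card := by
            gcongr <;> exact card_monF _ _
      _ = _ := by
        simp only [Finset.card_univ, Fintype.card_prod, Fintype.card_fun, Fintype.card_bool,
          Fintype.card_fin]
        ring
  refine (Finset.card_le_mul_card_image (mem C n) (2 ^ q) ?_).trans
    (Nat.mul_le_mul_left _ himg)
  intro E hE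
  rw [Finset.mem_image] at hE
  obtain ⟨π₀, hπ₀, hE⟩ := hE
  have hV₀ := hD π₀ hπ₀
  rw [hE] at hV₀
  obtain ⟨⟨α, β, α', β'⟩, M, Sc, Sr⟩ := E
  let PC : Finset (Fin n) := Finset.univ.filter (fun p => ∃ i j, Sc (α' p) i = true ∧ Sc (α' p) j = true ∧ i ≠ j)
  let PR : Finset (Fin n) := Finset.univ.filter (fun v => ∃ i j, Sr (β' v) i = true ∧ Sr (β' v) j = true ∧ i ≠ j)
  have hcard : PC.card + PR.card ≤ q := by
    obtain ⟨hR, -, hSc, hSr⟩ := hV₀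
    simp only at hR hSc hSr
    apply hR.hq
    · intro p hp
      simp only [PC, Finset.mem_filter, Finset.mem_univ, true_and] at hp
      obtain ⟨i, j, hi, hj, hij⟩ := hp
      obtain ⟨x, hx1, hx2⟩ := (hSc _ _).mp hi
      obtain ⟨y, hy1, hy2⟩ := (hSc _ _).mp hj
      exact ⟨x, y, hx1, hy1, by rw [hx2, hy2]; exact hij⟩
    · intro p hp
      simp only [PR, Finset.mem_filter, Finset.mem_univ, true_and] at hp
      obtain ⟨i, j, hi, hj, hij⟩ := hp
      obtain ⟨x, hx1, hx2⟩ := (hSr _ _).mp hi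
      obtain ⟨y, hy1, hy2⟩ := (hSr _ _).mp hj
      exact ⟨x, y, hx1, hy1, by rw [hx2, hy2]; exact hij⟩
  have hF : ∀ (S : Fin K → Fin k → Bool), ∃ F : Fin K → ℕ, ∀ i j, S i j = true →
      ∃ j' : Fin k, (j' : ℕ) = F i ∧ S i j' = true := by
    intro S
    have : ∀ i, ∃ f : ℕ, ∀ j, S i j = true → ∃ j' : Fin k, (j' : ℕ) = f ∧ S i j' = true := by
      intro i
      by_cases h : ∃ j, S i j = true
      · obtain ⟨j, hj⟩ := h
        exact ⟨j, fun _ _ => ⟨j, rfl, hj⟩⟩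
      · exact ⟨0, fun j hj => absurd ⟨j, hj⟩ h⟩
    choose F hF using this
    exact ⟨F, hF⟩
  obtain ⟨Fc, hFc⟩ := hF Sc
  obtain ⟨Fr, hFr⟩ := hF Sr
  let code : Equiv.Perm (Fin n) → Finset (Fin n) × Finset (Fin n) := fun π =>
    (PC.filter (fun p => (β (π p) : ℕ) = Fc (α' p)), PR.filter (fun v => (α (π.symm v) : ℕ) = Fr (β' v)))
  have : ((mem C n).filter (fun π => D π = ((α, β, α', β'), M, Sc, Sr))).card ≤
      (PC.powerset ×ˢ PR.powerset).card := by
    apply Finset.card_le_card_of_injOn code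
    · intro π _
      exact Finset.mem_product.mpr ⟨Finset.mem_powerset.mpr (Finset.filter_subset _ _),
        Finset.mem_powerset.mpr (Finset.filter_subset _ _)⟩
    · intro π hπ π' hπ' hc
      simp only [Finset.coe_filter, Set.mem_ofPred_eq] at hπ hπ'
      have hV := hD π hπ.1
      have hV' := hD π' hπ'.1
      rw [hπ.2] at hV
      rw [hπ'.2] at hV'
      obtain ⟨hR, hM, hSc, hSr⟩ := hV
      obtain ⟨hR', hM', hSc', hSr'⟩ := hV'
      simp only at hR hSc hSr hR' hSc' hSr' hM hM'
      simp only [code, Prod.mk.injEq] at hc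
      obtain ⟨c1, c2⟩ := hc
      have b1 : ∀ p, β (π p) = β (π' p) := by
        intro p
        by_contra hne
        have s1 : Sc (α' p) (β (π p)) = true := (hSc _ _).mpr ⟨p, rfl, rfl⟩
        have s2 : Sc (α' p) (β (π' p)) = true := (hSc' _ _).mpr ⟨p, rfl, rfl⟩
        have hp : p ∈ PC := by
          simp only [PC, Finset.mem_filter, Finset.mem_univ, true_and]
          exact ⟨_, _, s1, s2, hne⟩
        have hiff := Finset.ext_iff.mp c1 p
        simp only [Finset.mem_filter, hp, true_and] at hiff
        obtain ⟨j, hj, s3⟩ := hFc _ _ s1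
        obtain ⟨y, hy1, hy2⟩ := (hSc _ _).mp s2
        obtain ⟨z, hz1, hz2⟩ := (hSc _ _).mp s3
        by_cases ht : (β (π p) : ℕ) = Fc (α' p)
        · exact hne (Fin.ext (ht.trans (hiff.mp ht).symm))
        · have ht' := fun h => ht (hiff.mpr h)
          have := hR.c3 p y z hy1.symm hz1.symm (by rw [hy2]; exact hne)
            (by rw [hz2]; intro e; apply ht; rw [e, hj])
          rw [hy2, hz2] at this
          apply ht'
          rw [this, hj]
      have b2 : ∀ v, α (π.symm v) = α (π'.symm v) := by
        intro p
        by_contra hne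
        have s1 : Sr (β' p) (α (π.symm p)) = true := (hSr _ _).mpr ⟨π.symm p, by simp, rfl⟩
        have s2 : Sr (β' p) (α (π'.symm p)) = true := (hSr' _ _).mpr ⟨π'.symm p, by simp, rfl⟩
        have hp : p ∈ PR := by
          simp only [PR, Finset.mem_filter, Finset.mem_univ, true_and]
          exact ⟨_, _, s1, s2, hne⟩
        have hiff := Finset.ext_iff.mp c2 p
        simp only [Finset.mem_filter, hp, true_and] at hiff
        obtain ⟨j, hj, s3⟩ := hFr _ _ s1
        obtain ⟨y, hy1, hy2⟩ := (hSr _ _).mp s2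
        obtain ⟨z, hz1, hz2⟩ := (hSr _ _).mp s3
        by_cases ht : (α (π.symm p) : ℕ) = Fr (β' p)
        · exact hne (Fin.ext (ht.trans (hiff.mp ht).symm))
        · have ht' := fun h => ht (hiff.mpr h)
          have := hR.r3 (π.symm p) y z (by simp [hy1]) (by simp [hz1]) (by rw [hy2]; exact hne)
            (by rw [hz2]; intro e; apply ht; rw [e, hj])
          rw [hy2, hz2] at this
          apply ht'
          rw [this, hj]
      apply det π π' (fun p => (α p, β (π p))) (fun v => (α (π.symm v), β v)) (by simp) ?_ M
      · intro p r h1 h2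
        simp only [Prod.mk.injEq] at h1
        exact hM p r h1.1 h1.2 h2
      · intro p r h1 h2
        simp only [Prod.mk.injEq] at h1
        simp only [b1] at h1 ⊢
        exact hM' p r h1.1 h1.2 h2
      · intro p
        simp [b1, b2]
  refine this.trans ?_
  rw [Finset.card_product, Finset.card_powerset, Finset.card_powerset, ← pow_add]
  exact Nat.pow_le_pow_right (by norm_num) hcard

/-- `l` disjoint good windows below `z` -/
def Chain (Good : ℕ → ℕ → Prop) : ℕ → ℕ → Prop
  | 0, _ => True
  | l + 1, z => ∃ x y, Chain Good l x ∧ Good x y ∧ x ≤ y ∧ y < z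

lemma Chain.mono {Good : ℕ → ℕ → Prop} {l z z' : ℕ} (h : Chain Good l z) (hz : z ≤ z') :
    Chain Good l z' := by
  cases l with
  | zero => trivial
  | succ l =>
    obtain ⟨x, y, h1, h2, h3, h4⟩ := h
    exact ⟨x, y, h1, h2, h3, by omega⟩

lemma Chain.seq {Good : ℕ → ℕ → Prop} (l : ℕ) : ∀ z, Chain Good l z →
    ∃ x y : ℕ → ℕ, (∀ i < l, Good (x i) (y i) ∧ y i < z) ∧ ∀ i j, i < j → j < l → y i < x j := by
  induction l with
  | zero => intro z _; exact ⟨id, id, by simp, by simp⟩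
  | succ l ih =>
    rintro z ⟨a, b, h1, h2, h3, h4⟩
    obtain ⟨x, y, hx, hy⟩ := ih a h1
    refine ⟨fun i => if i = l then a else x i, fun i => if i = l then b else y i, ?_, ?_⟩
    · intro i hi
      by_cases h : i = l
      · simp [h, h2, h4]
      · have := hx i (by omega)
        simp only [h, if_false]
        exact ⟨this.1, by omega⟩
    · intro i j hij hj
      have h : i ≠ l := by omega
      simp only [h, if_false]
      by_cases h' : j = l
      · simp only [h', if_true]
        exact (hx i (by omega)).2
      · simp only [h', if_false]
        exact hy i j hij (by omega)

lemma greedy (Good : ℕ → ℕ → Prop) (m : ℕ) (hm : ∀ z, ¬ Chain Good m z) :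
    ∃ g : ℕ → ℕ, Monotone g ∧ (∀ x, g x ≤ 2 * m) ∧ ∀ x y, x < y → g x = g y → ¬ Good x y := by
  classical
  let g : ℕ → ℕ := fun z => Nat.findGreatest (fun l => Chain Good l z) m
  have hg : ∀ z, Chain Good (g z) z := by
    intro z
    exact Nat.findGreatest_spec (P := fun l => Chain Good l z) (Nat.zero_le m) trivial
  have gle : ∀ z, g z ≤ m := fun z => Nat.findGreatest_le m
  have glt : ∀ z, g z < m := by
    intro z
    rcases (gle z).lt_or_eq with h | h
    · exact h
    · exact absurd (h ▸ hg z) (hm z)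
  have gmon : Monotone g := by
    intro a b hab
    exact Nat.le_findGreatest (gle a) ((hg a).mono hab)
  refine ⟨fun z => g z + g (z + 1), ?_, ?_, ?_⟩
  · intro a b hab
    exact Nat.add_le_add (gmon hab) (gmon (by omega))
  · intro x
    have := gle x
    have := gle (x+1)
    simp only
    omega
  · intro x y hxy he hG
    simp only at he
    have h1 : g x ≤ g (x+1) := gmon (by omega)
    have h2 : g (x+1) ≤ g y := gmon (by omega)
    have h3 : g y ≤ g (y+1) := gmon (by omega)
    have h4 : Chain Good (g x + 1) (y + 1) := ⟨x, y, hg x, hG, hxy.le, by omega⟩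
    have h5 : g x + 1 ≤ g (y+1) := Nat.le_findGreatest (glt x) h4
    omega

/-- the cell of a point -/
def cell {n k : ℕ} (π : Equiv.Perm (Fin n)) (α β : Fin n → Fin k) (p : Fin n) : Fin k × Fin k :=
  (α p, β (π p))

/-- time in terms of coordinate value -/
def Tz {n k : ℕ} (π : Equiv.Perm (Fin n)) (α β : Fin n → Fin k) (B : Fin k × Fin k)
    (inc d : Bool) (z : ℤ) : ℕ :=
  (Finset.univ.filter (fun b => cell π α β b = B ∧ Yc π inc d b ≤ z)).card +
  (Finset.univ.filter (fun b => cell π α β b = B ∧ Yc π inc d b < z)).card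

lemma Tz_mono {n k : ℕ} (π : Equiv.Perm (Fin n)) (α β : Fin n → Fin k) (B : Fin k × Fin k)
    (inc d : Bool) : Monotone (Tz π α β B inc d) := by
  intro x y hxy
  unfold Tz
  apply Nat.add_le_add
  · apply Finset.card_le_card
    intro b hb
    simp only [Finset.mem_filter, Finset.mem_univ, true_and] at hb ⊢
    exact ⟨hb.1, hb.2.trans hxy⟩
  · apply Finset.card_le_card
    intro b hb
    simp only [Finset.mem_filter, Finset.mem_univ, true_and] at hb ⊢
    exact ⟨hb.1, hb.2.trans_le hxy⟩

lemma Yc_inj {n : ℕ} (π : Equiv.Perm (Fin n)) (inc d : Bool) : Function.Injective (Yc π inc d) := by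
  intro p q h
  cases d <;> cases inc <;> simp [Yc] at h <;> first | exact h | (exact Fin.ext (by omega)) |
    (exact π.injective (Fin.ext (by omega)))

lemma Tz_ne {n k : ℕ} (π : Equiv.Perm (Fin n)) (α β : Fin n → Fin k) (B : Fin k × Fin k)
    (inc d : Bool) (b p : Fin n) (hb : cell π α β b = B) (hp : p ≠ b) :
    Tz π α β B inc d (Yc π inc d p) ≠ Tz π α β B inc d (Yc π inc d b) := by
  have hY : Yc π inc d p ≠ Yc π inc d b := fun h => hp (Yc_inj π inc d h)
  -- strictness
  have st : ∀ x y : ℤ, x < y → (x = Yc π inc d b ∨ y = Yc π inc d b) →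
      Tz π α β B inc d x < Tz π α β B inc d y := by
    intro x y hxy hor
    unfold Tz
    have s1 : (Finset.univ.filter (fun b => cell π α β b = B ∧ Yc π inc d b ≤ x)) ⊆
        (Finset.univ.filter (fun b => cell π α β b = B ∧ Yc π inc d b ≤ y)) := by
      intro b hb
      simp only [Finset.mem_filter, Finset.mem_univ, true_and] at hb ⊢
      exact ⟨hb.1, hb.2.trans hxy.le⟩
    have s2 : (Finset.univ.filter (fun b => cell π α β b = B ∧ Yc π inc d b < x)) ⊆
        (Finset.univ.filter (fun b => cell π α β b = B ∧ Yc π inc d b < y)) := by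
      intro b hb
      simp only [Finset.mem_filter, Finset.mem_univ, true_and] at hb ⊢
      exact ⟨hb.1, hb.2.trans hxy⟩
    rcases hor with h | h
    · apply Nat.add_lt_add_of_le_of_lt (Finset.card_le_card s1)
      apply Finset.card_lt_card
      rw [Finset.ssubset_iff_of_subset s2]
      exact ⟨b, by simp [hb, ← h, hxy], by simp [h]⟩
    · apply Nat.add_lt_add_of_lt_of_le ?_ (Finset.card_le_card s2)
      apply Finset.card_lt_card
      rw [Finset.ssubset_iff_of_subset s1]
      exact ⟨b, by simp [hb, h], by simp [← h, hxy]⟩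
  rcases lt_or_gt_of_ne hY with h | h
  · exact (st _ _ h (Or.inr rfl)).ne
  · exact (st _ _ h (Or.inl rfl)).ne'

/-- `inc` is the correct direction of cell `B` -/
def IncOK {n k : ℕ} (π : Equiv.Perm (Fin n)) (α β : Fin n → Fin k) (B : Fin k × Fin k)
    (inc : Bool) : Prop :=
  ∀ p q, cell π α β p = B → cell π α β q = B → p < q → if inc then π p < π q else π q < π p

lemma exists_inc {n k : ℕ} {π : Equiv.Perm (Fin n)} {α β : Fin n → Fin k} (h : GR k n π α β)
    (B : Fin k × Fin k) : ∃ inc, IncOK π α β B inc := by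
  obtain ⟨i, j⟩ := B
  rcases h.mono i j with h | h
  · refine ⟨true, fun p q h1 h2 h3 => ?_⟩
    simp only [cell, Prod.mk.injEq] at h1 h2
    simpa using h p q h1.1 h2.1 h1.2 h2.2 h3
  · refine ⟨false, fun p q h1 h2 h3 => ?_⟩
    simp only [cell, Prod.mk.injEq] at h1 h2
    simpa using h p q h1.1 h2.1 h1.2 h2.2 h3

lemma Yc_agree {n k : ℕ} {π : Equiv.Perm (Fin n)} {α β : Fin n → Fin k} {B : Fin k × Fin k}
    {inc : Bool} (h : IncOK π α β B inc) (p q : Fin n) (hp : cell π α β p = B)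
    (hq : cell π α β q = B) (d d' : Bool) (hlt : Yc π inc d p < Yc π inc d q) :
    Yc π inc d' p < Yc π inc d' q := by
  rcases lt_trichotomy p q with h1 | h1 | h1
  · have h2 := h p q hp hq h1
    cases inc <;> cases d <;> cases d' <;> simp [Yc] at h2 hlt ⊢ <;> omega
  · subst h1; simp at hlt
  · have h2 := h q p hq hp h1
    cases inc <;> cases d <;> cases d' <;> simp [Yc] at h2 hlt ⊢ <;> omega

lemma Tz_agree {n k : ℕ} {π : Equiv.Perm (Fin n)} {α β : Fin n → Fin k} {B : Fin k × Fin k}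
    {inc : Bool} (h : IncOK π α β B inc) (p : Fin n) (hp : cell π α β p = B) (d d' : Bool) :
    Tz π α β B inc d (Yc π inc d p) = Tz π α β B inc d' (Yc π inc d' p) := by
  unfold Tz
  congr 2
  · ext b
    simp only [Finset.mem_filter, Finset.mem_univ, true_and]
    refine and_congr_right fun hb => ?_
    rw [← not_lt, ← not_lt, not_iff_not]
    exact ⟨Yc_agree h p b hp hb d d', Yc_agree h p b hp hb d' d⟩
  · ext b
    simp only [Finset.mem_filter, Finset.mem_univ, true_and]
    refine and_congr_right fun hb => ?_
    exact ⟨Yc_agree h b p hb hp d d', Yc_agree h b p hb hp d' d⟩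

/-- configurations: cells `A`, `B`, `C`, coordinate shared by `A`,`B`, and by `B`,`C` -/
abbrev Cfg (k : ℕ) : Type := ((Fin k × Fin k) × (Fin k × Fin k) × (Fin k × Fin k)) × Bool × Bool

/-- good windows for a configuration -/
def GoodW {n k : ℕ} (π : Equiv.Perm (Fin n)) (α β : Fin n → Fin k) (c : Cfg k) (inc : Bool)
    (x y : ℕ) : Prop :=
  ∃ P : Fin 3 → Fin n, cell π α β (P 0) = c.1.1 ∧ cell π α β (P 1) = c.1.2.1 ∧
    cell π α β (P 2) = c.1.2.2 ∧
    (∀ i, i ≠ 2 → x ≤ Tz π α β c.1.2.1 inc c.2.1 (Yc π inc c.2.1 (P i)) ∧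
      Tz π α β c.1.2.1 inc c.2.1 (Yc π inc c.2.1 (P i)) ≤ y) ∧
    (∀ i, i ≠ 0 → x ≤ Tz π α β c.1.2.1 inc c.2.2 (Yc π inc c.2.2 (P i)) ∧
      Tz π α β c.1.2.1 inc c.2.2 (Yc π inc c.2.2 (P i)) ≤ y)

/-- A long chain exists in the class for some admissible configuration. -/
def HasChain (C : Set Permu) (k : ℕ) (adm : Cfg k → Prop) (m : ℕ) : Prop :=
  ∃ (n : ℕ) (π : Equiv.Perm (Fin n)) (α β : Fin n → Fin k) (c : Cfg k) (inc : Bool) (z : ℕ),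
    (⟨n, π⟩ : Permu) ∈ C ∧ GR k n π α β ∧ adm c ∧ Chain (GoodW π α β c inc) m z

lemma chain_lower (C : Set Permu) (hC : IsPermClass C) (k m : ℕ) (adm : Cfg k → Prop)
    (h : HasChain C k adm m) (W : Finset (Fin m → Fin 3)) (hW : ∀ w ∈ W, NoCA w)
    (hd : ∀ c, adm c → ∀ w ∈ W, ∀ w' ∈ W, ∀ i j,
      (![c.1.1, c.1.2.1, c.1.2.2] : Fin 3 → _) (w i) = (![c.1.1, c.1.2.1, c.1.2.2] : Fin 3 → _) (w' j)
        → w i = w' j) :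
    W.card ≤ pcount C m * (m + 1) ^ (2 * k) := by
  obtain ⟨n, π, α, β, c, inc, z, hπ, hG, hadm, hch⟩ := h
  obtain ⟨x, y, hx, hy⟩ := hch.seq
  have hx' : ∀ i : Fin m, GoodW π α β c inc (x i) (y i) := fun i => (hx i i.2).1
  choose P h0 h1 h2 hab hbc using hx'
  refine lower_bound C hC π hπ α β hG P ![c.1.1, c.1.2.1, c.1.2.2] ?_ inc c.2.1 c.2.2 ?_ ?_ W hW
    (hd c hadm)
  · intro i t
    fin_cases t
    · exact h0 i
    · exact h1 i
    · exact h2 i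
  · intro i j s t hij hs ht
    by_contra hc
    have := Tz_mono π α β c.1.2.1 inc c.2.1 (not_lt.mp hc)
    have a1 := (hab i s hs).2
    have a2 := (hab j t ht).1
    have a3 := hy i j hij j.2
    omega
  · intro i j s t hij hs ht
    by_contra hc
    have := Tz_mono π α β c.1.2.1 inc c.2.2 (not_lt.mp hc)
    have a1 := (hbc i s hs).2
    have a2 := (hbc j t ht).1
    have a3 := hy i j hij j.2
    omega

/-- two points share the refined line in coordinate d -/
def Sh {n : ℕ} {κ : Type*} (π : Equiv.Perm (Fin n)) (γ δ : Fin n → κ) (d : Bool) (p q : Fin n) : Prop :=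
  if d then γ p = γ q else δ (π p) = δ (π q)

lemma refine_one {n k m : ℕ} {π : Equiv.Perm (Fin n)} {α β : Fin n → Fin k} (hG : GR k n π α β)
    (c : Cfg k) (hAB : c.1.1 ≠ c.1.2.1)
    (hno : ∀ inc z, ¬ Chain (GoodW π α β c inc) m z) :
    ∃ γ δ : Fin n → ℕ, Monotone γ ∧ Monotone δ ∧ (∀ p, γ p ≤ 2 * m) ∧ (∀ p, δ p ≤ 2 * m) ∧
      ∀ P : Fin 3 → Fin n, cell π α β (P 0) = c.1.1 → cell π α β (P 1) = c.1.2.1 →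
        cell π α β (P 2) = c.1.2.2 → Sh π γ δ c.2.1 (P 0) (P 1) → Sh π γ δ c.2.2 (P 2) (P 1) → False := by
  obtain ⟨⟨A, B, E⟩, d, d'⟩ := c
  simp only at *
  obtain ⟨inc, hinc⟩ := exists_inc hG B
  obtain ⟨g, gm, gb, gg⟩ := greedy _ m (hno inc)
  let T : Bool → Fin n → ℕ := fun d p => Tz π α β B inc d (Yc π inc d p)
  let γ : Fin n → ℕ := fun p => if inc then g (T true p) else 2 * m - g (T true p)
  let δ : Fin n → ℕ := fun v => g (T false (π.symm v))
  have hSh : ∀ d p q, Sh π γ δ d p q → g (T d p) = g (T d q) := by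
    intro d p q h
    cases d
    · simpa [Sh, δ] using h
    · have h1 := gb (T true p)
      have h2 := gb (T true q)
      cases inc
      · simp only [Sh, γ, if_true] at h
        simp only [Bool.false_eq_true, if_false] at h
        omega
      · simpa [Sh, γ] using h
  refine ⟨γ, δ, ?_, ?_, ?_, ?_, ?_⟩
  · intro p q hpq
    have hpq' : (p : ℕ) ≤ q := hpq
    cases inc
    · simp only [γ, Bool.false_eq_true, if_false]
      apply Nat.sub_le_sub_left
      apply gm
      apply Tz_mono
      simp [Yc, hpq]
    · simp only [γ, if_true]
      apply gm
      apply Tz_mono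
      simp [Yc, hpq]
  · intro p q hpq
    apply gm
    apply Tz_mono
    simp [Yc, hpq]
  · intro p
    simp only [γ]
    split_ifs
    · exact gb _
    · omega
  · intro p; exact gb _
  · intro P h0 h1 h2 s1 s2
    have e1 := hSh _ _ _ s1
    have e2 := hSh _ _ _ s2
    have hne : T d (P 0) ≠ T d (P 1) := by
      apply Tz_ne π α β B inc d (P 1) (P 0) h1
      intro e
      rw [e, h1] at h0
      exact hAB h0.symm
    have hag : T d (P 1) = T d' (P 1) := Tz_agree hinc (P 1) h1 d d'
    let x := min (T d (P 0)) (min (T d (P 1)) (T d' (P 2)))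
    let y := max (T d (P 0)) (max (T d (P 1)) (T d' (P 2)))
    have hxy : x < y := by simp only [x, y]; omega
    have gx : g x = g (T d (P 1)) := by
      simp only [x]
      rcases min_choice (T d (P 0)) (min (T d (P 1)) (T d' (P 2))) with h | h <;> rw [h]
      · exact e1
      · rcases min_choice (T d (P 1)) (T d' (P 2)) with h | h <;> rw [h]
        rw [e2, hag]
    have gy : g y = g (T d (P 1)) := by
      simp only [y]
      rcases max_choice (T d (P 0)) (max (T d (P 1)) (T d' (P 2))) with h | h <;> rw [h]
      · exact e1
      · rcases max_choice (T d (P 1)) (T d' (P 2)) with h | h <;> rw [h]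
        rw [e2, hag]
    apply gg x y hxy (gx.trans gy.symm)
    refine ⟨P, h0, h1, h2, ?_, ?_⟩
    · intro i hi
      change x ≤ T d (P i) ∧ T d (P i) ≤ y
      fin_cases i
      · simp only [x, y, Fin.zero_eta]; omega
      · simp only [x, y, Fin.mk_one]; omega
      · exact absurd rfl hi
    · intro i hi
      change x ≤ T d' (P i) ∧ T d' (P i) ≤ y
      fin_cases i
      · exact absurd rfl hi
      · simp only [x, y, Fin.mk_one]; omega
      · simp only [x, y, Fin.reduceFinMk]; omega

lemma refine_all (C : Set Permu) (k m : ℕ) (adm : Cfg k → Prop) (hadm : ∀ c, adm c → c.1.1 ≠ c.1.2.1)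
    (hno : ¬ HasChain C k adm m) {n : ℕ} {π : Equiv.Perm (Fin n)} (hπ : (⟨n, π⟩ : Permu) ∈ C)
    {α β : Fin n → Fin k} (hG : GR k n π α β) :
    ∃ α' β' : Fin n → Fin (k + Fintype.card (Cfg k) * (2 * m)), Monotone α' ∧ Monotone β' ∧
      (∀ x y, α' x = α' y → α x = α y) ∧ (∀ x y, β' x = β' y → β x = β y) ∧
      ∀ c, adm c → ∀ P : Fin 3 → Fin n, cell π α β (P 0) = c.1.1 → cell π α β (P 1) = c.1.2.1 →
        cell π α β (P 2) = c.1.2.2 → Sh π α' β' c.2.1 (P 0) (P 1) → Sh π α' β' c.2.2 (P 2) (P 1) →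
        False := by
  classical
  have hex : ∀ c : Cfg k, ∃ γ δ : Fin n → ℕ, Monotone γ ∧ Monotone δ ∧ (∀ p, γ p ≤ 2 * m) ∧
      (∀ p, δ p ≤ 2 * m) ∧ (adm c →
      ∀ P : Fin 3 → Fin n, cell π α β (P 0) = c.1.1 → cell π α β (P 1) = c.1.2.1 →
        cell π α β (P 2) = c.1.2.2 → Sh π γ δ c.2.1 (P 0) (P 1) → Sh π γ δ c.2.2 (P 2) (P 1) → False) := by
    intro c
    by_cases hc : adm c
    · obtain ⟨γ, δ, h1, h2, h3, h4, h5⟩ := refine_one (m := m) hG c (hadm c hc)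
        (fun inc z hz => hno ⟨n, π, α, β, c, inc, z, hπ, hG, hc, hz⟩)
      exact ⟨γ, δ, h1, h2, h3, h4, fun _ => h5⟩
    · exact ⟨fun _ => 0, fun _ => 0, monotone_const, monotone_const, by simp, by simp,
        fun h => absurd h hc⟩
  choose γ δ mγ mδ bγ bδ hγδ using hex
  -- general combination of lines
  have comb : ∀ (a : Fin n → Fin k) (u : Cfg k → Fin n → ℕ), Monotone a → (∀ c, Monotone (u c)) →
      (∀ c p, u c p ≤ 2 * m) →
      ∃ a' : Fin n → Fin (k + Fintype.card (Cfg k) * (2 * m)), Monotone a' ∧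
        ∀ x y, a' x = a' y → a x = a y ∧ ∀ c, u c x = u c y := by
    intro a u ha hu hb
    have hlt : ∀ p, (a p : ℕ) + ∑ c, u c p < k + Fintype.card (Cfg k) * (2 * m) := by
      intro p
      have : ∑ c, u c p ≤ ∑ c : Cfg k, 2 * m := Finset.sum_le_sum (fun c _ => hb c p)
      rw [Finset.sum_const, Finset.card_univ, smul_eq_mul] at this
      have := (a p).2
      omega
    have key : ∀ x y, x ≤ y → (a x : ℕ) + ∑ c, u c x = (a y : ℕ) + ∑ c, u c y →
        a x = a y ∧ ∀ c, u c x = u c y := by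
      intro x y hxy he
      have h1 : (a x : ℕ) ≤ a y := ha hxy
      have h2 : ∀ c ∈ (Finset.univ : Finset (Cfg k)), u c x ≤ u c y := fun c _ => hu c hxy
      have h3 := Finset.sum_le_sum h2
      refine ⟨Fin.ext (by omega), ?_⟩
      have h4 : ∑ c, u c x = ∑ c, u c y := by omega
      intro c
      exact (Finset.sum_eq_sum_iff_of_le h2).mp h4 c (Finset.mem_univ c)
    refine ⟨fun p => ⟨_, hlt p⟩, ?_, ?_⟩
    · intro x y hxy
      rw [Fin.le_def]
      exact Nat.add_le_add (ha hxy) (Finset.sum_le_sum (fun c _ => hu c hxy))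
    · intro x y h
      simp only [Fin.mk.injEq] at h
      rcases le_total x y with hxy | hxy
      · exact key x y hxy h
      · have := key y x hxy h.symm
        exact ⟨this.1.symm, fun c => (this.2 c).symm⟩
  obtain ⟨α', ma, ha⟩ := comb α γ hG.ma mγ bγ
  obtain ⟨β', mb, hb⟩ := comb β δ hG.mb mδ bδ
  refine ⟨α', β', ma, mb, fun x y h => (ha x y h).1, fun x y h => (hb x y h).1, ?_⟩
  intro c hc P h0 h1 h2 s1 s2
  have tr : ∀ d p q, Sh π α' β' d p q → Sh π (γ c) (δ c) d p q := by
    intro d p q h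
    cases d
    · simp only [Sh, Bool.false_eq_true, if_false] at h ⊢
      exact (hb _ _ h).2 c
    · simp only [Sh, if_true] at h ⊢
      exact (ha _ _ h).2 c
  exact hγδ c hc P h0 h1 h2 (tr _ _ _ s1) (tr _ _ _ s2)

/-- pair configurations -/
def adm1 {k : ℕ} (c : Cfg k) : Prop := c.1.1 ≠ c.1.2.1 ∧ c.1.2.2 = c.1.1 ∧ c.2.2 = c.2.1

/-- triple configurations -/
def adm2 {k : ℕ} (c : Cfg k) : Prop := c.1.1 ≠ c.1.2.1 ∧ c.1.2.2 ≠ c.1.2.1 ∧ c.1.1 ≠ c.1.2.2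

lemma level1 (C : Set Permu) (k m : ℕ) (hG : ∀ π ∈ C, ∃ α β, GR k π.1 π.2 α β)
    (hno : ¬ HasChain C k adm1 m) (n : ℕ) :
    let K := k + Fintype.card (Cfg k) * (2 * m)
    pcount C n ≤ 2 ^ 0 * ((n + 1) ^ (2 * k + 2 * K) * 2 ^ (k * k + 2 * (K * k))) := by
  intro K
  apply upper_bound
  intro π hπ
  have hπ : (⟨n, π⟩ : Permu) ∈ C := by simpa [mem] using hπ
  obtain ⟨α, β, hg⟩ := hG _ hπ
  simp only at α β hg
  obtain ⟨α', β', ma, mb, ra, rb, hc⟩ := refine_all C k m adm1 (fun c h => h.1) hno hπ hg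
  have hcol : ∀ x y, α' x = α' y → β (π x) = β (π y) := by
    intro x y h
    by_contra hne
    refine hc ((cell π α β x, cell π α β y, cell π α β x), true, true) ⟨?_, rfl, rfl⟩ ![x, y, x]
      rfl rfl rfl (by simpa [Sh] using h) (by simpa [Sh] using h)
    intro e
    simp only [cell, Prod.mk.injEq] at e
    exact hne e.2
  have hrow : ∀ x y, β' (π x) = β' (π y) → α x = α y := by
    intro x y h
    by_contra hne
    refine hc ((cell π α β x, cell π α β y, cell π α β x), false, false) ⟨?_, rfl, rfl⟩ ![x, y, x]
      rfl rfl rfl (by simpa [Sh] using h) (by simpa [Sh] using h)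
    intro e
    simp only [cell, Prod.mk.injEq] at e
    exact hne e.1
  refine ⟨α, β, α', β', hg, ma, mb, ra, rb, ?_, ?_, ?_⟩
  · intro x y z h1 h2 h3 h4
    exact absurd (hcol _ _ h1) h3
  · intro x y z h1 h2 h3 h4
    exact absurd (hrow _ _ h1) h3
  · intro PC PR h1 h2
    have e1 : PC = ∅ := by
      rw [Finset.eq_empty_iff_forall_notMem]
      intro p hp
      obtain ⟨x, y, a, b, c⟩ := h1 p hp
      exact c (hcol _ _ (a.trans b.symm))
    have e2 : PR = ∅ := by
      rw [Finset.eq_empty_iff_forall_notMem]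
      intro p hp
      obtain ⟨x, y, a, b, c⟩ := h2 p hp
      exact c (hrow _ _ (a.trans b.symm))
    simp [e1, e2]

lemma level2 (C : Set Permu) (k m : ℕ) (hG : ∀ π ∈ C, ∃ α β, GR k π.1 π.2 α β)
    (hno : ¬ HasChain C k adm2 m) (n : ℕ) :
    let K := k + Fintype.card (Cfg k) * (2 * m)
    pcount C n ≤ 2 ^ n * ((n + 1) ^ (2 * k + 2 * K) * 2 ^ (k * k + 2 * (K * k))) := by
  classical
  intro K
  apply upper_bound
  intro π hπ
  have hπ : (⟨n, π⟩ : Permu) ∈ C := by simpa [mem] using hπ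
  obtain ⟨α, β, hg⟩ := hG _ hπ
  simp only at α β hg
  obtain ⟨α', β', ma, mb, ra, rb, hc⟩ := refine_all C k m adm2 (fun c h => h.1) hno hπ hg
  have hc' : ∀ d d' x b y, cell π α β x ≠ cell π α β b → cell π α β y ≠ cell π α β b →
      cell π α β x ≠ cell π α β y → Sh π α' β' d x b → Sh π α' β' d' y b → False := by
    intro d d' x b y h1 h2 h3 s1 s2
    exact hc ((cell π α β x, cell π α β b, cell π α β y), d, d') ⟨h1, h2, h3⟩ ![x, b, y]
      rfl rfl rfl s1 s2
  have cne1 : ∀ x y, α x ≠ α y → cell π α β x ≠ cell π α β y := by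
    intro x y h e
    simp only [cell, Prod.mk.injEq] at e
    exact h e.1
  have cne2 : ∀ x y, β (π x) ≠ β (π y) → cell π α β x ≠ cell π α β y := by
    intro x y h e
    simp only [cell, Prod.mk.injEq] at e
    exact h e.2
  refine ⟨α, β, α', β', hg, ma, mb, ra, rb, ?_, ?_, ?_⟩
  · intro x y z h1 h2 h3 h4
    by_contra h5
    exact hc' true true y x z (cne2 _ _ h3.symm) (cne2 _ _ h4.symm) (cne2 _ _ h5)
      (by simp [Sh, h1]) (by simp [Sh, h2])
  · intro x y z h1 h2 h3 h4
    by_contra h5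
    exact hc' false false y x z (cne1 _ _ h3.symm) (cne1 _ _ h4.symm) (cne1 _ _ h5)
      (by simp [Sh, h1]) (by simp [Sh, h2])
  · intro PC PR h1 h2
    have hdis : Disjoint (PC.map π.toEmbedding) PR := by
      rw [Finset.disjoint_left]
      intro v hv hv'
      simp only [Finset.mem_map, Equiv.coe_toEmbedding] at hv
      obtain ⟨p, hp, rfl⟩ := hv
      obtain ⟨x, y, a1, a2, a3⟩ := h1 p hp
      obtain ⟨u, w, b1, b2, b3⟩ := h2 _ hv'
      obtain ⟨x', hx1, hx2⟩ : ∃ x', α' x' = α' p ∧ β (π x') ≠ β (π p) := by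
        by_cases h : β (π x) = β (π p)
        · exact ⟨y, a2, fun e => a3 (h.trans e.symm)⟩
        · exact ⟨x, a1, h⟩
      obtain ⟨u', hu1, hu2⟩ : ∃ u', β' (π u') = β' (π p) ∧ α u' ≠ α p := by
        by_cases h : α u = α p
        · exact ⟨w, b2, fun e => b3 (h.trans e.symm)⟩
        · exact ⟨u, b1, h⟩
      have e1 := ra _ _ hx1
      refine hc' true false x' p u' (cne2 _ _ hx2) (cne1 _ _ hu2) (cne1 _ _ ?_)
        (by simp [Sh, hx1]) (by simp [Sh, hu1])
      rw [e1]; exact hu2.symm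
    have := Finset.card_le_univ (PC.map π.toEmbedding ∪ PR)
    rw [Finset.card_union_of_disjoint hdis] at this
    simpa using this

lemma lower1 (C : Set Permu) (hC : IsPermClass C) (k m : ℕ) (h : HasChain C k adm1 m) :
    (2 : ℝ) ^ m ≤ (pcount C m : ℝ) * ((m : ℝ) + 1) ^ (2 * k) := by
  obtain ⟨W, hW, hc⟩ := words2_count m
  have hd : ∀ c : Cfg k, adm1 c → ∀ w ∈ W, ∀ w' ∈ W, ∀ i j,
      (![c.1.1, c.1.2.1, c.1.2.2] : Fin 3 → _) (w i) = (![c.1.1, c.1.2.1, c.1.2.2] : Fin 3 → _) (w' j)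
        → w i = w' j := by
    intro c hc w hw w' hw' i j he
    have h1 := hW w hw i
    have h2 := hW w' hw' j
    have hne := hc.1
    generalize w i = s at *
    generalize w' j = t at *
    fin_cases s <;> fin_cases t <;> first
      | rfl
      | (exact absurd rfl h1)
      | (exact absurd rfl h2)
      | (exact absurd he hne)
      | (exact absurd he.symm hne)
  have := chain_lower C hC k m adm1 h W (fun w hw i hi hh => hW w hw _ hh.1) hd
  refine hc.trans ?_
  exact_mod_cast this

lemma lower2 (C : Set Permu) (hC : IsPermClass C) (k m : ℕ) (h : HasChain C k adm2 m) :
    ((3 + Real.sqrt 5) / 2) ^ m ≤ (pcount C m : ℝ) * ((m : ℝ) + 1) ^ (2 * k) := by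
  obtain ⟨W, V, -, hW, -, hc, -⟩ := words_count m
  have hd : ∀ c : Cfg k, adm2 c → ∀ w ∈ W, ∀ w' ∈ W, ∀ i j,
      (![c.1.1, c.1.2.1, c.1.2.2] : Fin 3 → _) (w i) = (![c.1.1, c.1.2.1, c.1.2.2] : Fin 3 → _) (w' j)
        → w i = w' j := by
    intro c hc w hw w' hw' i j he
    obtain ⟨n1, n2, n3⟩ := hc
    generalize w i = s at *
    generalize w' j = t at *
    fin_cases s <;> fin_cases t <;> first
      | rfl
      | (exact absurd he n1)
      | (exact absurd he.symm n1)
      | (exact absurd he n2)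
      | (exact absurd he.symm n2)
      | (exact absurd he n3)
      | (exact absurd he.symm n3)
  have := chain_lower C hC k m adm2 h W hW hd
  refine hc.trans ?_
  exact_mod_cast this

lemma grid_exists (C : Set Permu) (hg : Griddable MonotoneClass C) :
    ∃ k, ∀ π ∈ C, ∃ α β, GR k π.1 π.2 α β := by
  obtain ⟨k, hk⟩ := hg
  refine ⟨k, ?_⟩
  intro π hπ
  obtain ⟨t, u, ht, hu, c, r, mc, mr, c0, c1, r0, r1, hcell⟩ := hk π hπ
  have line : ∀ (t : ℕ) (c : Fin (t+1) → ℕ), Monotone c → c 0 = 1 → c (Fin.last t) = π.1 + 1 →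
      ∃ a : Fin π.1 → Fin t, Monotone a ∧ ∀ p, c (a p).castSucc ≤ (p : ℕ) + 1 ∧ (p : ℕ) + 1 < c (a p).succ := by
    intro t c mc c0 c1
    have : ∀ p : Fin π.1, ∃ i : Fin t, c i.castSucc ≤ (p : ℕ) + 1 ∧ (p : ℕ) + 1 < c i.succ := by
      intro p
      by_contra hne
      push Not at hne
      have hall : ∀ i, c i ≤ (p : ℕ) + 1 := by
        intro i
        induction i using Fin.induction with
        | zero => omega
        | succ i ih => exact hne i ih
      have := hall (Fin.last t)
      have := p.2
      omega
    choose a ha using this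
    refine ⟨a, ?_, ha⟩
    intro p q hpq
    by_contra hlt
    push Not at hlt
    have h1 : c (a q).succ ≤ c (a p).castSucc := mc (by
      rw [Fin.le_def]; simp only [Fin.val_succ, Fin.val_castSucc]; exact hlt)
    have h2 := (ha p).1
    have h3 := (ha q).2
    have : (p : ℕ) ≤ q := hpq
    omega
  obtain ⟨a, am, ha⟩ := line t c mc c0 c1
  obtain ⟨b, bm, hb⟩ := line u r mr r0 r1
  refine ⟨fun p => Fin.castLE ht (a p), fun v => Fin.castLE hu (b v), ?_, ?_, ?_⟩
  · intro p q h; exact am h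
  · intro p q h; exact bm h
  · intro i j
    by_cases hex : ∃ x, Fin.castLE ht (a x) = i ∧ Fin.castLE hu (b (π.2 x)) = j
    · obtain ⟨x, rfl, rfl⟩ := hex
      obtain ⟨σ, hσ, f, fm, fr, fo⟩ := hcell (a x) (b (π.2 x))
      have hin : ∀ p, Fin.castLE ht (a p) = Fin.castLE ht (a x) →
          Fin.castLE hu (b (π.2 p)) = Fin.castLE hu (b (π.2 x)) → ∃ s, f s = p := by
        intro p h1 h2
        have h1 : a p = a x := by simpa using h1
        have h2 : b (π.2 p) = b (π.2 x) := by simpa using h2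
        have : p ∈ Set.range f := by
          rw [fr]
          have e1 := ha p
          have e2 := hb (π.2 p)
          rw [h1] at e1
          rw [h2] at e2
          exact ⟨e1.1, e1.2, e2.1, e2.2⟩
        exact this
      have hmono : StrictMono σ.2 ∨ StrictAnti σ.2 := by
        rcases hσ with h | h
        · exact h
        · left
          intro y
          have := y.2
          omega
      rcases hmono with h | h
      · left
        intro p q h1 h2 h3 h4 hpq
        obtain ⟨s, rfl⟩ := hin p h1 h3
        obtain ⟨v, rfl⟩ := hin q h2 h4
        exact (fo s v).mp (h (fm.lt_iff_lt.mp hpq))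
      · right
        intro p q h1 h2 h3 h4 hpq
        obtain ⟨s, rfl⟩ := hin p h1 h3
        obtain ⟨v, rfl⟩ := hin q h2 h4
        exact (fo v s).mp (h (fm.lt_iff_lt.mp hpq))
    · left
      intro p q h1 h2 h3 h4
      exact absurd ⟨p, h1, h3⟩ hex

lemma poly_root (E : ℝ) (hE : 0 < E) (D : ℕ) :
    Tendsto (fun n : ℕ => (E * ((n : ℝ) + 1) ^ D) ^ ((n : ℝ)⁻¹)) atTop (nhds 1) := by
  have h1 : Tendsto (fun n : ℕ => (Real.log E + D * Real.log ((n : ℝ) + 1)) / (n : ℝ)) atTop (nhds 0) := by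
    have a1 : Tendsto (fun n : ℕ => Real.log E / (n : ℝ)) atTop (nhds 0) :=
      tendsto_const_div_atTop_nhds_zero_nat _
    have a2 : Tendsto (fun n : ℕ => Real.log ((n : ℝ) + 1) / (n : ℝ)) atTop (nhds 0) := by
      have b1 : Tendsto (fun x : ℝ => Real.log x ^ 1 / (1 * x + (-1))) atTop (nhds 0) :=
        Real.tendsto_pow_log_div_mul_add_atTop 1 (-1) 1 one_ne_zero
      have b2 : Tendsto (fun n : ℕ => (n : ℝ) + 1) atTop atTop :=
        tendsto_atTop_add_const_right _ _ tendsto_natCast_atTop_atTop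
      refine (b1.comp b2).congr ?_
      intro n
      simp
    have := a1.add (a2.const_mul (D : ℝ))
    simp only [mul_zero, add_zero] at this
    refine this.congr ?_
    intro n
    ring
  have h2 := (Real.continuous_exp.tendsto 0).comp h1
  rw [Real.exp_zero] at h2
  refine h2.congr ?_
  intro n
  have hp : 0 < ((n : ℝ) + 1) ^ D := by positivity
  rw [Real.rpow_def_of_pos (mul_pos hE hp), Real.log_mul hE.ne' hp.ne', Real.log_pow]
  simp [div_eq_mul_inv]

/-- The lower comparison sequence. -/
lemma low_seq (L : ℝ) (hL : 0 < L) (D : ℕ) (a : ℕ → ℝ)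
    (h : ∀ n, L ^ n ≤ a n * ((n : ℝ) + 1) ^ D) :
    ∃ v : ℕ → ℝ, Tendsto v atTop (nhds L) ∧ ∀ᶠ n in atTop, v n ≤ a n ^ ((n : ℝ)⁻¹) := by
  refine ⟨fun n => L / ((1 * ((n : ℝ) + 1) ^ D) ^ ((n : ℝ)⁻¹)), ?_, ?_⟩
  · have := (tendsto_const_nhds (x := L)).div (poly_root 1 one_pos D) one_ne_zero
    rw [div_one] at this
    exact this
  · filter_upwards [eventually_gt_atTop 0] with n hn
    have hp : 0 < ((n : ℝ) + 1) ^ D := by positivity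
    have h1 : L ^ n / ((n : ℝ) + 1) ^ D ≤ a n := by
      rw [div_le_iff₀ hp]; exact h n
    have h2 := Real.rpow_le_rpow (by positivity) h1 (by positivity : (0:ℝ) ≤ (n : ℝ)⁻¹)
    rw [Real.div_rpow (by positivity) hp.le, Real.pow_rpow_inv_natCast hL.le (by omega)] at h2
    simpa using h2

lemma up_seq (L : ℝ) (hL : 0 < L) (E : ℝ) (hE : 0 < E) (D : ℕ) (a : ℕ → ℝ) (ha : ∀ n, 0 ≤ a n)
    (h : ∀ n, a n ≤ L ^ n * (E * ((n : ℝ) + 1) ^ D)) :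
    ∃ v : ℕ → ℝ, Tendsto v atTop (nhds L) ∧ ∀ᶠ n in atTop, a n ^ ((n : ℝ)⁻¹) ≤ v n := by
  refine ⟨fun n => L * ((E * ((n : ℝ) + 1) ^ D) ^ ((n : ℝ)⁻¹)), ?_, ?_⟩
  · have := (tendsto_const_nhds (x := L)).mul (poly_root E hE D)
    simpa using this
  · filter_upwards [eventually_gt_atTop 0] with n hn
    have h2 := Real.rpow_le_rpow (ha n) (h n) (by positivity : (0:ℝ) ≤ (n : ℝ)⁻¹)
    rwa [Real.mul_rpow (by positivity) (by positivity),
      Real.pow_rpow_inv_natCast hL.le (by omega)] at h2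

lemma mem_empty_mono (C : Set Permu) (hC : IsPermClass C) (n N : ℕ) (hn : n ≤ N)
    (h : pcount C n = 0) : pcount C N = 0 := by
  rw [pcount_eq, Finset.card_eq_zero] at *
  rw [Finset.eq_empty_iff_forall_notMem] at *
  intro π hπ
  have hπ : (⟨N, π⟩ : Permu) ∈ C := by simpa [mem] using hπ
  obtain ⟨e, σ, f, h1, h2, h3, h4⟩ := pattern_exists π (Fin.castLE hn) (Fin.castLE_injective hn)
  apply h σ
  simp only [mem, Finset.mem_filter, Finset.mem_univ, true_and]
  exact hC _ _ ⟨f, h1, h3⟩ hπ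

lemma up_cast (a q n D e : ℕ) (h : a ≤ 2 ^ q * ((n + 1) ^ D * 2 ^ e)) :
    (a : ℝ) ≤ 2 ^ q * (2 ^ e * ((n : ℝ) + 1) ^ D) := by
  have : (a : ℝ) ≤ 2 ^ q * (((n : ℝ) + 1) ^ D * 2 ^ e) := by exact_mod_cast h
  linarith

theorem final (C : Set Permu) (hC : IsPermClass C)
    (hg : Griddable MonotoneClass C)
    (h : ugr C < (((3 + Real.sqrt 5) / 2 : ℝ) : EReal)) :
    ∃ L : ℝ,
      Tendsto (fun n : ℕ => (pcount C n : ℝ) ^ ((n : ℝ)⁻¹)) atTop (nhds L) ∧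
      (L = 0 ∨ L = 1 ∨ L = 2) := by
  obtain ⟨k, hG⟩ := grid_exists C hg
  by_cases hfin : ∃ n, pcount C n = 0
  · obtain ⟨n₀, hn₀⟩ := hfin
    refine ⟨0, ?_, Or.inl rfl⟩
    apply tendsto_const_nhds.congr'
    filter_upwards [eventually_gt_atTop n₀] with n hn
    rw [mem_empty_mono C hC n₀ n hn.le hn₀, Nat.cast_zero, Real.zero_rpow]
    have : n ≠ 0 := by omega
    positivity
  push Not at hfin
  by_cases h1 : ∀ m, HasChain C k adm1 m
  · have h2 : ∃ m, ¬ HasChain C k adm2 m := by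
      by_contra hc
      push Not at hc
      have hpos : (0:ℝ) < (3 + Real.sqrt 5) / 2 := by positivity
      obtain ⟨v, hv, hle⟩ := low_seq _ hpos (2 * k) (fun n => (pcount C n : ℝ))
        (fun m => lower2 C hC k m (hc m))
      have hv' : Tendsto (fun n => ((v n : ℝ) : EReal)) atTop
          (nhds (((3 + Real.sqrt 5) / 2 : ℝ) : EReal)) :=
        (continuous_coe_real_ereal.tendsto _).comp hv
      have hlim : (((3 + Real.sqrt 5) / 2 : ℝ) : EReal) ≤ ugr C := by
        rw [← hv'.limsup_eq]
        refine limsup_le_limsup ?_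
        filter_upwards [hle] with n hn
        exact EReal.coe_le_coe_iff.mpr hn
      exact absurd h (not_lt.mpr hlim)
    obtain ⟨m, hm⟩ := h2
    obtain ⟨v, hv, hle⟩ := low_seq 2 two_pos (2 * k) (fun n => (pcount C n : ℝ))
        (fun m => lower1 C hC k m (h1 m))
    obtain ⟨u, hu, hle'⟩ := up_seq 2 two_pos _ (by positivity) _ (fun n => (pcount C n : ℝ))
      (fun n => Nat.cast_nonneg _)
      (fun n => up_cast _ n n _ _ (level2 C k m hG hm n))
    exact ⟨2, tendsto_of_tendsto_of_tendsto_of_le_of_le' hv hu hle hle', by simp⟩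
  · push Not at h1
    obtain ⟨m, hm⟩ := h1
    obtain ⟨D, e, hb⟩ : ∃ D e : ℕ, ∀ n : ℕ, (pcount C n : ℝ) ≤ 1 ^ n * (2 ^ e * ((n : ℝ) + 1) ^ D) := by
      refine ⟨2 * k + 2 * (k + Fintype.card (Cfg k) * (2 * m)), k * k + 2 * ((k + Fintype.card (Cfg k) * (2 * m)) * k), fun n => ?_⟩
      have := up_cast _ 0 n _ _ (level1 C k m hG hm n)
      rw [pow_zero] at this
      rw [one_pow]
      exact this
    obtain ⟨u, hu, hle'⟩ := up_seq 1 one_pos (2 ^ e) (by positivity) D (fun n => (pcount C n : ℝ))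
      (fun n => Nat.cast_nonneg _) hb
    refine ⟨1, tendsto_of_tendsto_of_tendsto_of_le_of_le' tendsto_const_nhds hu ?_ hle', by simp⟩
    filter_upwards with n
    apply Real.one_le_rpow
    · exact_mod_cast Nat.one_le_iff_ne_zero.mpr (hfin n)
    · positivity

end MG

/-- If a permutation class is griddable by the class of monotone
permutations and has upper growth rate less than `1 + φ = (3 + √5)/2`, then its growth
rate exists and is `0`, `1`, or `2`. -/
theorem monotone_griddable_growth_rates
    (C : Set Permu) (hC : IsPermClass C)
    (hg : Griddable MonotoneClass C)
    (h : ugr C < (((3 + Real.sqrt 5) / 2 : ℝ) : EReal)) :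
    ∃ L : ℝ,
      Tendsto (fun n : ℕ => (pcount C n : ℝ) ^ ((n : ℝ)⁻¹)) atTop (nhds L) ∧
      (L = 0 ∨ L = 1 ∨ L = 2) := by
  exact MG.final C hC hg h
end

section
/- If α is a sum indecomposable permutation of length at least 10 that contains at least 3 sum indecomposable permutations of length 3 and at least 3 sum indecomposable permutations of length 4, then gr(⊕Sub(α)) > ξ. -/
open Filter

/-- The direct sum of two permutations, on underlying finite types. -/
def permSum {m n : ℕ} (π : Equiv.Perm (Fin m)) (σ : Equiv.Perm (Fin n)) :
    Equiv.Perm (Fin (m + n)) :=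
  finSumFinEquiv.symm.trans ((Equiv.sumCongr π σ).trans finSumFinEquiv)

/-- The sum `π ⊕ σ` of two permutations. -/
def psum (π σ : Permu) : Permu := ⟨π.1 + σ.1, permSum π.2 σ.2⟩

/-- The skew sum of two permutations, on underlying finite types. -/
def permSkew {m n : ℕ} (π : Equiv.Perm (Fin m)) (σ : Equiv.Perm (Fin n)) :
    Equiv.Perm (Fin (m + n)) :=
  finSumFinEquiv.symm.trans ((Equiv.sumCongr π σ).trans
    (((Equiv.sumComm (Fin m) (Fin n)).trans finSumFinEquiv).trans (finCongr (Nat.add_comm n m))))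

/-- The skew sum `π ⊖ σ` of two permutations. -/
def pskew (π σ : Permu) : Permu := ⟨π.1 + σ.1, permSkew π.2 σ.2⟩

/-- A set of permutations is sum closed if it is closed under `⊕`. -/
def SumClosed (C : Set Permu) : Prop := ∀ π σ : Permu, π ∈ C → σ ∈ C → psum π σ ∈ C

/-- A set of permutations is skew closed if it is closed under `⊖`. -/
def SkewClosed (C : Set Permu) : Prop := ∀ π σ : Permu, π ∈ C → σ ∈ C → pskew π σ ∈ C

/-- A permutation is sum indecomposable if it is not the sum of two nonempty permutations. -/
def SumIndec (τ : Permu) : Prop := ¬ ∃ π σ : Permu, 0 < π.1 ∧ 0 < σ.1 ∧ τ = psum π σ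

/-- A permutation is skew indecomposable if it is not the skew sum of two nonempty
permutations. -/
def SkewIndec (τ : Permu) : Prop := ¬ ∃ π σ : Permu, 0 < π.1 ∧ 0 < σ.1 ∧ τ = pskew π σ

/-- `Sub π` : the class of all permutations contained in `π`. -/
def SubCl (π : Permu) : Set Permu := {σ | PLe σ π}

/-- The sum closure of a set of permutations: the smallest sum closed class containing it. -/
def sumClosure (C : Set Permu) : Set Permu :=
  ⋂₀ {D : Set Permu | IsPermClass D ∧ SumClosed D ∧ C ⊆ D}

/-- The skew closure of a set of permutations: the smallest skew closed class containing it. -/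
def skewClosure (C : Set Permu) : Set Permu :=
  ⋂₀ {D : Set Permu | IsPermClass D ∧ SkewClosed D ∧ C ⊆ D}

/-- The cell class `G_γ`: permutations `π` with `gr(⊕Sub(π)) < γ` or `gr(⊖Sub(π)) < γ`.
(These growth rates exist, so they coincide with the upper growth rates used here.) -/
noncomputable def cellClass (γ : ℝ) : Set Permu :=
  {π | ugr (sumClosure (SubCl π)) < (γ : EReal) ∨ ugr (skewClosure (SubCl π)) < (γ : EReal)}
/-- No cut: for every proper prefix of positions there is an inversion crossing it. -/
def NoCut (τ : Permu) : Prop :=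
  ∀ k : ℕ, 0 < k → k < τ.1 → ∃ i j : Fin τ.1, i.1 < k ∧ k ≤ j.1 ∧ τ.2 j < τ.2 i

lemma psum_left (π σ : Permu) (i : Fin π.1) :
    (psum π σ).2 (Fin.castAdd σ.1 i) = Fin.castAdd σ.1 (π.2 i) := by
  change finSumFinEquiv (Equiv.sumCongr π.2 σ.2 (finSumFinEquiv.symm (Fin.castAdd σ.1 i))) = _
  simp

lemma psum_right (π σ : Permu) (i : Fin σ.1) :
    (psum π σ).2 (Fin.natAdd π.1 i) = Fin.natAdd π.1 (σ.2 i) := by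
  change finSumFinEquiv (Equiv.sumCongr π.2 σ.2 (finSumFinEquiv.symm (Fin.natAdd π.1 i))) = _
  simp

lemma psum_lt (π σ : Permu) (i : Fin (psum π σ).1) :
    i.1 < π.1 ↔ ((psum π σ).2 i).1 < π.1 := by
  change Fin (π.1 + σ.1) at i
  induction i using Fin.addCases with
  | left i => rw [psum_left]; simp
  | right i => rw [psum_right]; simp

lemma NoCut.indec {τ : Permu} (h : NoCut τ) : SumIndec τ := by
  rintro ⟨π, σ, h1, h2, rfl⟩
  obtain ⟨i, j, hi, hj, hij⟩ := h π.1 h1 (by simp [psum]; exact h2)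
  have a := (psum_lt π σ i).1 hi
  have b := (psum_lt π σ j).not.1 (by omega)
  rw [Fin.lt_def] at hij
  omega

lemma SumIndec.noCut {τ : Permu} (h : SumIndec τ) : NoCut τ := by
  intro k hk hkn
  by_contra hc
  push Not at hc
  apply h
  obtain ⟨n, τ⟩ := τ
  simp only at hkn hc
  obtain ⟨l, rfl⟩ : ∃ l, n = k + l := ⟨n - k, by omega⟩
  have key : ∀ i : Fin (k + l), i.1 < k → (τ i).1 < k := by
    intro i hi
    by_contra hik
    -- all positions `≥ k` have values `≥ τ i ≥ k`, except none: count values `≤ k`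
    have hsub : (Finset.univ.filter fun v : Fin (k + l) => v.1 < k) ⊆
        ((Finset.univ.filter fun x : Fin (k + l) => x.1 < k).erase i).image τ := by
      intro v hv
      simp only [Finset.mem_filter, Finset.mem_univ, true_and] at hv
      simp only [Finset.mem_image, Finset.mem_erase, Finset.mem_filter, Finset.mem_univ, true_and]
      refine ⟨τ.symm v, ⟨?_, ?_⟩, by simp⟩
      · rintro rfl
        simp at hik; omega
      · by_contra hge
        have := hc i (τ.symm v) hi (by omega)
        simp only [Equiv.apply_symm_apply, Fin.le_def] at this
        omega
    have h1 := Finset.card_le_card hsub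
    have h2 := Finset.card_image_le (s := (Finset.univ.filter fun x : Fin (k + l) => x.1 < k).erase i) (f := τ)
    have h3 := Finset.card_erase_lt_of_mem (s := Finset.univ.filter fun x : Fin (k + l) => x.1 < k) (a := i) (by simp [hi])
    omega
  have hmaps : Set.MapsTo (finSumFinEquiv.trans (τ.trans finSumFinEquiv.symm) : Equiv.Perm (Fin k ⊕ Fin l))
      (Set.range Sum.inl) (Set.range Sum.inl) := by
    rintro _ ⟨i, rfl⟩
    have := key (Fin.castAdd l i) (by simp)
    refine ⟨⟨_, this⟩, ?_⟩
    apply finSumFinEquiv.injective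
    simp
  obtain ⟨⟨a, b⟩, hab⟩ := Equiv.Perm.mem_sumCongrHom_range_of_perm_mapsTo_inl hmaps
  refine ⟨⟨k, a⟩, ⟨l, b⟩, hk, by simp; omega, ?_⟩
  simp only [psum, permSum]
  have hab' : Equiv.sumCongr a b = finSumFinEquiv.trans (τ.trans finSumFinEquiv.symm) := hab
  rw [hab']
  congr 1
  ext x
  simp

lemma psum_inj {σ π σ' π' : Permu} (h : psum σ π = psum σ' π')
    (hs : SumIndec σ) (hs' : SumIndec σ') (p : 0 < σ.1) (p' : 0 < σ'.1) : σ = σ' ∧ π = π' := by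
  have main : ∀ {σ π σ' π' : Permu}, psum σ π = psum σ' π' → SumIndec σ' → 0 < σ.1 →
      σ'.1 ≤ σ.1 := by
    intro σ π σ' π' h hs' p
    by_contra hlt
    push Not at hlt
    obtain ⟨i, j, hi, hj, hij⟩ := hs'.noCut σ.1 p hlt
    have hh : ∀ x : Fin (psum σ' π').1, x.1 < σ.1 ↔ ((psum σ' π').2 x).1 < σ.1 := by
      rw [← h]; exact psum_lt σ π
    have a := (hh (Fin.castAdd π'.1 i)).1 (by simpa using hi)
    have b := (hh (Fin.castAdd π'.1 j)).not.1 (by simpa using hj)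
    rw [psum_left] at a b
    simp only [Fin.val_castAdd, Fin.lt_def] at a b hij
    omega
  have e : σ.1 = σ'.1 := le_antisymm (main h.symm hs p') (main h hs' p)
  have e2 : σ.1 + π.1 = σ'.1 + π'.1 := congrArg Sigma.fst h
  obtain ⟨m, σ⟩ := σ
  obtain ⟨m', σ'⟩ := σ'
  obtain ⟨n, π⟩ := π
  obtain ⟨n', π'⟩ := π'
  simp only at e e2
  subst e
  obtain rfl : n = n' := by omega
  have h' : permSum σ π = permSum σ' π' := by
    simpa [psum] using h
  have h'' : Equiv.sumCongr σ π = Equiv.sumCongr σ' π' := by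
    ext x : 1
    have := congrArg (fun e => finSumFinEquiv.symm (e (finSumFinEquiv x))) h'
    simpa [permSum] using this
  have := Equiv.Perm.sumCongrHom_injective (α := Fin m) (β := Fin n) (a₁ := (σ, π)) (a₂ := (σ', π')) h''
  simp only [Prod.mk.injEq] at this
  exact ⟨by rw [this.1], by rw [this.2]⟩

lemma exists_std {n m : ℕ} (g : Fin n → Fin m) (hg : Function.Injective g) :
    ∃ σ : Equiv.Perm (Fin n), ∀ i j, σ i < σ j ↔ g i < g j := by
  have hc : (Finset.univ.image g).card = n := by
    rw [Finset.card_image_of_injective _ hg]; simp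
  let o := (Finset.univ.image g).orderIsoOfFin hc
  let u : Fin n → (Finset.univ.image g) := fun i => ⟨g i, by simp⟩
  have hu : Function.Injective (fun i => o.symm (u i)) := by
    intro i j h
    have := o.symm.injective h
    exact hg (congrArg Subtype.val this)
  refine ⟨Equiv.ofBijective _ (Finite.injective_iff_bijective.1 hu), ?_⟩
  intro i j
  simp [u]

/-- The inversion graph. -/
def invG (τ : Permu) : SimpleGraph (Fin τ.1) where
  Adj i j := (i < j ∧ τ.2 j < τ.2 i) ∨ (j < i ∧ τ.2 i < τ.2 j)
  symm := ⟨fun _ _ h => h.symm⟩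
  loopless := ⟨fun _ h => by simp at h⟩

lemma NoCut.conn {τ : Permu} (h : NoCut τ) (hp : 0 < τ.1) : (invG τ).Connected := by
  have step : ∀ k (hk : k + 1 < τ.1),
      (invG τ).Reachable ⟨k, by omega⟩ ⟨k + 1, hk⟩ := by
    intro k hk
    obtain ⟨a, b, ha, hb, hab⟩ := h (k + 1) (by omega) hk
    have hlt : a < b := by rw [Fin.lt_def]; omega
    have rab : (invG τ).Reachable a b := SimpleGraph.Adj.reachable (Or.inl ⟨hlt, hab⟩)
    have r1 : (invG τ).Reachable ⟨k, by omega⟩ a := by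
      by_cases c : τ.2 b < τ.2 ⟨k, by omega⟩
      · refine SimpleGraph.Reachable.trans (SimpleGraph.Adj.reachable (Or.inl ⟨?_, c⟩)) rab.symm
        rw [Fin.lt_def]; simp only; omega
      · rcases eq_or_ne a ⟨k, by omega⟩ with e | e
        · rw [e]
        · refine SimpleGraph.Adj.reachable (Or.inr ⟨?_, lt_of_le_of_lt (not_lt.1 c) hab⟩)
          have : a.1 ≠ k := fun h => e (Fin.ext h)
          rw [Fin.lt_def]; simp only; omega
    have r2 : (invG τ).Reachable a ⟨k + 1, hk⟩ := by
      by_cases c : τ.2 ⟨k + 1, hk⟩ < τ.2 a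
      · exact SimpleGraph.Adj.reachable (Or.inl ⟨by rw [Fin.lt_def]; exact ha, c⟩)
      · rcases eq_or_ne b ⟨k + 1, hk⟩ with e | e
        · rw [← e]; exact rab
        · refine rab.trans (SimpleGraph.Adj.reachable (Or.inr ⟨?_, lt_of_lt_of_le hab (not_lt.1 c)⟩))
          have : b.1 ≠ k + 1 := fun h => e (Fin.ext h)
          rw [Fin.lt_def]; simp only; omega
    exact r1.trans r2
  have all : ∀ k (hk : k < τ.1), (invG τ).Reachable ⟨0, hp⟩ ⟨k, hk⟩ := by
    intro k
    induction k with
    | zero => intro _; rfl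
    | succ k ih => intro hk; exact (ih (by omega)).trans (step k hk)
  have : Nonempty (Fin τ.1) := ⟨⟨0, hp⟩⟩
  exact SimpleGraph.Connected.mk fun x y => (all x.1 x.2).symm.trans (all y.1 y.2)

lemma exists_delete (τ : Permu) (h : SumIndec τ) (n : ℕ) (hn : τ.1 = n + 1) (hp : 0 < n) :
    ∃ σ : Permu, σ.1 = n ∧ SumIndec σ ∧ PLe σ τ := by
  have hconn := h.noCut.conn (by omega)
  obtain ⟨m, τ⟩ := τ
  simp only at hn
  subst hn
  have : Nontrivial (Fin (n + 1)) := Fin.nontrivial_iff_two_le.2 (by omega)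
  obtain ⟨p, hpc⟩ := SimpleGraph.Connected.exists_connected_induce_compl_singleton_of_finite_nontrivial hconn
  obtain ⟨σ, hσ⟩ := exists_std (fun i => τ (p.succAbove i))
    (τ.injective.comp (Fin.succAbove_right_injective (p := p)))
  refine ⟨⟨n, σ⟩, rfl, NoCut.indec ?_, p.succAbove, Fin.strictMono_succAbove p, hσ⟩
  intro k hk hkn
  simp only at hkn
  let u : ({p}ᶜ : Set (Fin (n + 1))) := ⟨p.succAbove ⟨0, hp⟩, by simp [Fin.succAbove_ne]⟩
  let v : ({p}ᶜ : Set (Fin (n + 1))) := ⟨p.succAbove ⟨k, hkn⟩, by simp [Fin.succAbove_ne]⟩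
  obtain ⟨w⟩ := hpc.preconnected u v
  obtain ⟨d, _, hd1, hd2⟩ := w.exists_boundary_dart {x | x.1 < p.succAbove ⟨k, hkn⟩}
    (by simp only [Set.mem_ofPred_eq, u]; exact Fin.strictMono_succAbove p (by simpa [Fin.lt_def] using hk))
    (by simp [v])
  obtain ⟨⟨⟨x, hx⟩, ⟨y, hy⟩⟩, hadj⟩ := d
  simp only [Set.mem_compl_iff, Set.mem_singleton_iff] at hx hy
  obtain ⟨i, rfl⟩ := Fin.exists_succAbove_eq hx
  obtain ⟨j, rfl⟩ := Fin.exists_succAbove_eq hy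
  simp only [Set.mem_ofPred_eq] at hd1 hd2
  have hd1 := (Fin.strictMono_succAbove p).lt_iff_lt.1 hd1
  have hd2 := (Fin.strictMono_succAbove p).le_iff_le.1 (not_lt.1 hd2)
  simp only [Fin.lt_def, Fin.le_def] at hd1 hd2
  refine ⟨i, j, hd1, hd2, (hσ j i).2 ?_⟩
  simp only [invG, SimpleGraph.induce_adj] at hadj
  rcases hadj with ⟨_, hh⟩ | ⟨hh, _⟩
  · exact hh
  · have hh := (Fin.strictMono_succAbove p).lt_iff_lt.1 hh
    rw [Fin.lt_def] at hh
    omega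

lemma PLe.trans {a b c : Permu} (h : PLe a b) (h' : PLe b c) : PLe a c := by
  obtain ⟨f, hf, hf'⟩ := h
  obtain ⟨g, hg, hg'⟩ := h'
  exact ⟨g ∘ f, hg.comp hf, fun i j => (hf' i j).trans (hg' _ _)⟩

lemma PLe.refl (a : Permu) : PLe a a := ⟨id, strictMono_id, fun _ _ => Iff.rfl⟩

lemma exists_indec (α : Permu) (hα : SumIndec α) (n : ℕ) (hn : 0 < n) (hna : n ≤ α.1) :
    ∃ σ : Permu, PLe σ α ∧ SumIndec σ ∧ σ.1 = n := by
  obtain ⟨d, hd⟩ : ∃ d, α.1 = n + d := ⟨α.1 - n, by omega⟩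
  induction d generalizing n with
  | zero => exact ⟨α, PLe.refl α, hα, by omega⟩
  | succ d ih =>
    obtain ⟨σ, h1, h2, h3⟩ := ih (n + 1) (by omega) (by omega) (by omega)
    obtain ⟨σ', a, b, c⟩ := exists_delete σ h2 n h3 hn
    exact ⟨σ', c.trans h1, b, a⟩

lemma finite_len (n : ℕ) (P : Permu → Prop) : {σ : Permu | P σ ∧ σ.1 = n}.Finite := by
  apply (Set.finite_range (fun s : Equiv.Perm (Fin n) => (⟨n, s⟩ : Permu))).subset
  rintro ⟨m, s⟩ ⟨_, h⟩
  simp only at h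
  subst h
  exact ⟨s, rfl⟩

/-- number of indecomposables of length `n` below `α` -/
noncomputable def scount (α : Permu) (n : ℕ) : ℕ :=
  Set.ncard {σ : Permu | (PLe σ α ∧ SumIndec σ) ∧ σ.1 = n}

lemma scount_pos (α : Permu) (hα : SumIndec α) (n : ℕ) (hn : 0 < n) (hna : n ≤ α.1) :
    1 ≤ scount α n := by
  obtain ⟨σ, a, b, c⟩ := exists_indec α hα n hn hna
  exact (Set.ncard_pos (finite_len n _)).2 ⟨σ, ⟨a, b⟩, c⟩

lemma count_rec (α : Permu) (n : ℕ) (hn : 10 ≤ n) :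
    ∑ k ∈ Finset.Icc 1 10, scount α k * pcount (sumClosure (SubCl α)) (n - k)
      ≤ pcount (sumClosure (SubCl α)) n := by
  classical
  set C := sumClosure (SubCl α) with hC
  have hsum : SumClosed C := by
    intro π σ hπ hσ D hD
    exact hD.2.1 π σ (hπ D hD) (hσ D hD)
  have hsub : SubCl α ⊆ C := fun x hx D hD => hD.2.2 hx
  let T : ℕ → Finset Permu := fun k => (finite_len k (fun σ => PLe σ α ∧ SumIndec σ)).toFinset
  let A : ℕ → Finset Permu := fun k => (finite_len k (fun σ => σ ∈ C)).toFinset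
  have hT : ∀ k, scount α k = (T k).card := fun k => Set.ncard_eq_toFinset_card _ _
  have hA : ∀ k, pcount C k = (A k).card := fun k => Set.ncard_eq_toFinset_card _ _
  simp only [hT, hA, ← Finset.card_product]
  rw [← Finset.card_sigma]
  apply Finset.card_le_card_of_injOn (fun x => psum x.2.1 x.2.2)
  · rintro ⟨k, σ, π⟩ hx
    simp only [T, A, Finset.coe_sigma, Set.mem_sigma_iff, Finset.mem_coe, Finset.mem_product,
      Set.Finite.mem_toFinset, Set.mem_ofPred_eq, Finset.mem_Icc] at hx ⊢
    obtain ⟨hk, ⟨⟨h1, h2⟩, h3⟩, h4, h5⟩ := hx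
    refine ⟨hsum _ _ (hsub h1) h4, ?_⟩
    simp only [psum]
    omega
  · rintro ⟨k, σ, π⟩ hx ⟨k', σ', π'⟩ hx' he
    simp only [T, A, Finset.coe_sigma, Set.mem_sigma_iff, Finset.mem_coe, Finset.mem_product,
      Set.Finite.mem_toFinset, Set.mem_ofPred_eq, Finset.mem_Icc] at hx hx' he
    obtain ⟨hk, ⟨⟨h1, h2⟩, h3⟩, h4, h5⟩ := hx
    obtain ⟨hk', ⟨⟨h1', h2'⟩, h3'⟩, h4', h5'⟩ := hx'
    obtain ⟨e1, e2⟩ := psum_inj he h2 h2' (by omega) (by omega)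
    subst e1 e2
    obtain rfl : k = k' := by omega
    rfl

lemma count_pos (α : Permu) (h : 1 ≤ α.1) (n : ℕ) : 1 ≤ pcount (sumClosure (SubCl α)) n := by
  have hone : (⟨1, 1⟩ : Permu) ∈ SubCl α := by
    refine ⟨fun _ => ⟨0, h⟩, fun i j hij => ?_, fun i j => ?_⟩
    · have : i = j := Subsingleton.elim (α := Fin 1) i j
      simp [this] at hij
    · have : i = j := Subsingleton.elim (α := Fin 1) i j
      simp [this]
  have hzero : (⟨0, 1⟩ : Permu) ∈ SubCl α :=
    ⟨fun i => Fin.elim0 i, fun i => Fin.elim0 i, fun i => Fin.elim0 i⟩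
  suffices ∃ π ∈ sumClosure (SubCl α), π.1 = n by
    obtain ⟨π, h1, h2⟩ := this
    exact (Set.ncard_pos (finite_len n _)).2 ⟨π, h1, h2⟩
  induction n with
  | zero => exact ⟨_, fun D hD => hD.2.2 hzero, rfl⟩
  | succ n ih =>
    obtain ⟨π, h1, h2⟩ := ih
    exact ⟨psum π ⟨1, 1⟩, fun D hD => hD.2.1 _ _ (h1 D hD) (hD.2.2 hone), by simp [psum, h2]⟩

lemma count_lower (a : ℕ → ℝ) (h1 : ∀ n, 1 ≤ a n)
    (hrec : ∀ n, a (n + 9) + a (n + 8) + 3 * a (n + 7) + 3 * a (n + 6) + a (n + 5) + a (n + 4)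
      + a (n + 3) + a (n + 2) + a (n + 1) + a n ≤ a (n + 10)) (n : ℕ) :
    ((219 / 95 : ℝ) ^ 10)⁻¹ * (219 / 95 : ℝ) ^ n ≤ a n := by
  induction n using Nat.strong_induction_on with
  | _ n ih =>
    by_cases hn : n < 10
    · refine le_trans ?_ (h1 n)
      rw [inv_mul_le_one₀ (by positivity)]
      exact pow_le_pow_right₀ (by norm_num) hn.le
    · obtain ⟨m, rfl⟩ : ∃ m, n = m + 10 := ⟨n - 10, by omega⟩
      have i0 := ih m (by omega)
      have i1 := ih (m + 1) (by omega)
      have i2 := ih (m + 2) (by omega)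
      have i3 := ih (m + 3) (by omega)
      have i4 := ih (m + 4) (by omega)
      have i5 := ih (m + 5) (by omega)
      have i6 := ih (m + 6) (by omega)
      have i7 := ih (m + 7) (by omega)
      have i8 := ih (m + 8) (by omega)
      have i9 := ih (m + 9) (by omega)
      have hr := hrec m
      have hp : 0 < (219 / 95 : ℝ) ^ m := by positivity
      simp only [pow_add] at *
      generalize (219 / 95 : ℝ) ^ m = t at *
      norm_num at *
      linarith

lemma limsup_lower (a : ℕ → ℝ) (c r : ℝ) (hc : 0 < c) (hr : 0 < r)
    (h : ∀ n, c * r ^ n ≤ a n) :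
    (r : EReal) ≤ limsup (fun n : ℕ => ((a n ^ ((n : ℝ)⁻¹) : ℝ) : EReal)) atTop := by
  have ht : Tendsto (fun n : ℕ => c ^ ((n : ℝ)⁻¹) * r) atTop (nhds r) := by
    have h0 : Tendsto (fun n : ℕ => ((n : ℝ)⁻¹)) atTop (nhds 0) :=
      tendsto_inv_atTop_nhds_zero_nat
    have h1 := ((Real.continuousAt_const_rpow hc.ne' (b := 0)).tendsto.comp h0).mul_const r
    simpa using h1
  have ht' : Tendsto (fun n : ℕ => ((c ^ ((n : ℝ)⁻¹) * r : ℝ) : EReal)) atTop (nhds (r : EReal)) :=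
    (continuous_coe_real_ereal.tendsto r).comp ht
  rw [← ht'.limsup_eq]
  refine limsup_le_limsup ?_
  filter_upwards [eventually_gt_atTop 0] with n hn
  rw [EReal.coe_le_coe_iff]
  have : c ^ ((n : ℝ)⁻¹) * r = (c * r ^ n) ^ ((n : ℝ)⁻¹) := by
    rw [Real.mul_rpow hc.le (by positivity), Real.pow_rpow_inv_natCast hr.le hn.ne']
  rw [this]
  exact Real.rpow_le_rpow (by positivity) (h n) (by positivity)

lemma xi_lt (ξ : ℝ) (hroot : ξ ^ 5 - 2 * ξ ^ 4 - ξ ^ 2 - ξ - 1 = 0) : ξ < 219 / 95 := by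
  by_contra h
  push Not at h
  obtain ⟨y, rfl⟩ : ∃ y, ξ = 219 / 95 + y := ⟨ξ - 219 / 95, by ring⟩
  have hy : 0 ≤ y := by linarith
  have h2 : 0 ≤ y ^ 2 := by positivity
  have h3 : 0 ≤ y ^ 3 := by positivity
  have h4 : 0 ≤ y ^ 4 := by positivity
  have h5 : 0 ≤ y ^ 5 := by positivity
  ring_nf at hroot
  linarith

/-- If a sum indecomposable permutation `α` of length at least `10`
contains at least `3` sum indecomposable permutations of length `3` and at least `3` of
length `4`, then `gr(⊕Sub(α)) > ξ`. -/
theorem sum_closure_growth_above_xi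
    (ξ : ℝ) (hpos : 0 < ξ) (hroot : ξ ^ 5 - 2 * ξ ^ 4 - ξ ^ 2 - ξ - 1 = 0)
    (α : Permu) (hα : SumIndec α) (hlen : 10 ≤ α.1)
    (h3 : 3 ≤ Set.ncard {σ : Permu | PLe σ α ∧ SumIndec σ ∧ σ.1 = 3})
    (h4 : 3 ≤ Set.ncard {σ : Permu | PLe σ α ∧ SumIndec σ ∧ σ.1 = 4}) :
    (ξ : EReal) < ugr (sumClosure (SubCl α)) := by
  have hg : ∀ n, (1:ℝ) ≤ (pcount (sumClosure (SubCl α)) n : ℝ) := fun n => by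
    exact_mod_cast count_pos α (by omega) n
  have e3 : 3 ≤ scount α 3 := by simpa [scount, and_assoc] using h3
  have e4 : 3 ≤ scount α 4 := by simpa [scount, and_assoc] using h4
  have hs : ∀ k, 0 < k → k ≤ 10 → 1 ≤ scount α k := fun k h h' =>
    scount_pos α hα k h (by omega)
  have hlow := count_lower (fun n => (pcount (sumClosure (SubCl α)) n : ℝ)) hg (by
    intro n
    have hr := count_rec α (n + 10) (by omega)
    simp only [Finset.sum_Icc_succ_top (show 1 ≤ 9 + 1 by omega), Finset.sum_Icc_succ_top (show 1 ≤ 8 + 1 by omega), Finset.sum_Icc_succ_top (show 1 ≤ 7 + 1 by omega), Finset.sum_Icc_succ_top (show 1 ≤ 6 + 1 by omega), Finset.sum_Icc_succ_top (show 1 ≤ 5 + 1 by omega), Finset.sum_Icc_succ_top (show 1 ≤ 4 + 1 by omega), Finset.sum_Icc_succ_top (show 1 ≤ 3 + 1 by omega), Finset.sum_Icc_succ_top (show 1 ≤ 2 + 1 by omega), Finset.sum_Icc_succ_top (show 1 ≤ 1 + 1 by omega), Finset.Icc_self, Finset.sum_singleton, Nat.reduceAdd, Nat.reduceSubDiff,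 Nat.add_sub_cancel] at hr
    generalize pcount (sumClosure (SubCl α)) = a at *
    have m1 := Nat.mul_le_mul_right (a (n + 9)) (hs 1 (by omega) (by omega))
    have m2 := Nat.mul_le_mul_right (a (n + 8)) (hs 2 (by omega) (by omega))
    have m3 := Nat.mul_le_mul_right (a (n + 7)) e3
    have m4 := Nat.mul_le_mul_right (a (n + 6)) e4
    have m5 := Nat.mul_le_mul_right (a (n + 5)) (hs 5 (by omega) (by omega))
    have m6 := Nat.mul_le_mul_right (a (n + 4)) (hs 6 (by omega) (by omega))
    have m7 := Nat.mul_le_mul_right (a (n + 3)) (hs 7 (by omega) (by omega))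
    have m8 := Nat.mul_le_mul_right (a (n + 2)) (hs 8 (by omega) (by omega))
    have m9 := Nat.mul_le_mul_right (a (n + 1)) (hs 9 (by omega) (by omega))
    have m10 := Nat.mul_le_mul_right (a n) (hs 10 (by omega) (by omega))
    norm_cast
    omega)
  refine lt_of_lt_of_le (EReal.coe_lt_coe_iff.2 (xi_lt ξ hroot)) ?_
  exact limsup_lower _ _ _ (by positivity) (by norm_num) hlow
end
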